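/- arXiv:1003.0040 — 3 statements merged into one kernel-verified Lean document; each statement's English description precedes it below -/
import Mathlib

section
/- For m = 3, 4, 5, the number of connected components of the topological subspace {x ∈ H0 ⊂ ℝ^m : ∑_{i∈I} x_i ≠ 0 for every nonempty proper subset I ⊂ [m]} (the number of chambers of the restriction to H0 of the all-subset arrangement) equals 6 for m = 3, equals 32 for m = 4, and equals 370 for m = 5. -/
open scoped BigOperators

/-- The number of chambers of the restriction to `H0` of the all-subset
arrangement in `ℝ^m`, i.e. the number of connected components of
`{x ∈ H0 : ∑_{i∈I} xᵢ ≠ 0 for every nonempty proper I ⊂ [m]}`. -/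
noncomputable def numChambersAllSubset (m : ℕ) : ℕ :=
  Nat.card (ConnectedComponents
    {x : EuclideanSpace ℝ (Fin m) // (∑ i, x i = 0) ∧
      ∀ I : Finset (Fin m), I.Nonempty → I ≠ Finset.univ →
        ∑ i ∈ I, x i ≠ 0})

/-- If a continuous map to a discrete space has preconnected fibres, then the connected components
of its domain correspond to the points of its range. -/
theorem natCard_connectedComponents_eq_ncard_range {X Y : Type*} [TopologicalSpace X]
    [TopologicalSpace Y] [DiscreteTopology Y] {f : X → Y} (hf : Continuous f)
    (hfib : ∀ y, IsPreconnected (f ⁻¹' {y})) :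
    Nat.card (ConnectedComponents X) = (Set.range f).ncard := by
  have hinj : Function.Injective hf.connectedComponentsLift := by
    intro a b
    induction a using Quotient.inductionOn with | _ a
    induction b using Quotient.inductionOn with | _ b
    intro hab
    have hab' : f a = f b := hab
    refine ConnectedComponents.coe_eq_coe'.2 ?_
    exact (hfib (f b)).subset_connectedComponent (x := b) rfl hab'
  have hrange : Set.range hf.connectedComponentsLift = Set.range f := by
    rw [← (ConnectedComponents.surjective_coe (α := X)).range_comp]
    rfl
  rw [← hrange, ← Nat.card_coe_set_eq]
  exact Nat.card_congr (Equiv.ofInjective _ hinj)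

namespace AllSubset

open Set

/-- The number whose binary digits at the places `1, …, k` are given by `s`. -/
def code (s : ℕ → Bool) : ℕ → ℕ
  | 0 => 0
  | k + 1 => code s k + if s (k + 1) then 2 ^ (k + 1) else 0

theorem code_lt (s : ℕ → Bool) (k : ℕ) : code s k < 2 ^ (k + 1) := by
  induction k with
  | zero => simp [code]
  | succ k ih => rw [code, pow_succ 2 (k + 1)]; split_ifs <;> omega

theorem testBit_code (s : ℕ → Bool) (k j : ℕ) :
    (code s k).testBit j = (decide (1 ≤ j ∧ j ≤ k) && s j) := by
  induction k with
  | zero =>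
    have : ¬ (1 ≤ j ∧ j ≤ 0) := by omega
    rw [decide_eq_false this, code, Nat.zero_testBit, Bool.false_and]
  | succ k ih =>
    have hsplit : code s (k + 1) = 2 ^ (k + 1) * (s (k + 1)).toNat + code s k := by
      rw [code]; cases s (k + 1) <;> simp [add_comm]
    rw [hsplit, Nat.testBit_two_pow_mul_add _ (code_lt s k)]
    split_ifs with h
    · rw [ih]
      congr 2
      simp only [eq_iff_iff]
      omega
    · obtain rfl | h' := eq_or_lt_of_le (not_lt.1 h)
      · cases s (k + 1) <;> simp
      · have h1 : ¬ (1 ≤ j ∧ j ≤ k + 1) := by omega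
        have h2 : (s (k + 1)).toNat < 2 ^ (j - (k + 1)) :=
          lt_of_lt_of_le (Bool.toNat_lt _)
            (Nat.pow_le_pow_right two_pos (by omega : 1 ≤ j - (k + 1)))
        rw [decide_eq_false h1, Nat.testBit_lt_two_pow h2, Bool.false_and]

theorem code_eq_code_iff {s t : ℕ → Bool} {k : ℕ} :
    code s k = code t k ↔ ∀ j, 1 ≤ j → j ≤ k → s j = t j := by
  constructor
  · intro h j h1 h2
    have := congrArg (Nat.testBit · j) h
    simpa [testBit_code, h1, h2] using this
  · intro h
    refine Nat.eq_of_testBit_eq fun j => ?_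
    rw [testBit_code, testBit_code]
    by_cases hj : 1 ≤ j ∧ j ≤ k
    · simp [hj, h j hj.1 hj.2]
    · simp [hj]

/-- Whether the sign at place `k` of `q` agrees with the signs at every two complementary binary
submasks of `k` having equal signs. -/
def IsConsistentAt (k q : ℕ) : Bool :=
  (List.range k).all fun a =>
    a &&& k != a || q.testBit a != q.testBit (k ^^^ a) || q.testBit k == q.testBit a

/-- The codes of the sign patterns at the places `1, …, k` which are consistent at each place. -/
def consistentCodes : ℕ → List ℕ
  | 0 => [0]
  | k + 1 => (consistentCodes k ++ (consistentCodes k).map (· + 2 ^ (k + 1))).filter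
      (IsConsistentAt (k + 1))

theorem code_mem_consistentCodes {s : ℕ → Bool} {N : ℕ}
    (hs : ∀ a b k, 1 ≤ a → 1 ≤ b → k ≤ N → a &&& k = a → k ^^^ a = b → s a = s b → s k = s a)
    {k : ℕ} (hk : k ≤ N) : code s k ∈ consistentCodes k := by
  induction k with
  | zero => simp [code, consistentCodes]
  | succ k ih =>
    rw [consistentCodes, List.mem_filter]
    constructor
    · have := ih (by omega)
      rw [code]
      split_ifs <;> simp [this]
    · simp only [IsConsistentAt, List.all_eq_true, List.mem_range, Bool.or_eq_true, bne_iff_ne,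
        beq_iff_eq]
      intro a ha
      by_cases hsub : a &&& (k + 1) = a
      swap
      · exact Or.inl (Or.inl hsub)
      by_cases ha0 : a = 0
      · subst ha0
        simp only [Nat.xor_zero]
        tauto
      have hb0 : (k + 1) ^^^ a ≠ 0 := by
        rw [Ne, Nat.xor_eq_zero_iff]; omega
      have hbk : (k + 1) ^^^ a ≤ k + 1 := by
        have : ((k + 1) ^^^ a) &&& (k + 1) = (k + 1) ^^^ a := by
          refine Nat.eq_of_testBit_eq fun i => ?_
          have := congrArg (Nat.testBit · i) hsub
          simp only [Nat.testBit_and, Nat.testBit_xor] at this ⊢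
          revert this
          cases a.testBit i <;> cases (k + 1).testBit i <;> simp
        rw [← this]
        exact Nat.and_le_right
      have h := hs a _ (k + 1) (by omega) (by omega) hk hsub rfl
      have h1 : 1 ≤ a ∧ a ≤ k + 1 := by omega
      have h2 : 1 ≤ (k + 1) ^^^ a ∧ (k + 1) ^^^ a ≤ k + 1 := by omega
      simp only [testBit_code, h1, h2, and_self, decide_true, Bool.true_and, le_refl,
        Nat.le_add_left]
      tauto

/-- The sum of the coordinates `x i` over the binary digits `i` of `j`. -/
def maskSum {R : Type*} [AddCommMonoid R] {m : ℕ} (x : Fin m → R) (j : ℕ) : R :=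
  ∑ i : Fin m, if j.testBit i then x i else 0

theorem maskSum_eq_sum_filter {R : Type*} [AddCommMonoid R] {m : ℕ} (x : Fin m → R) (j : ℕ) :
    maskSum x j = ∑ i ∈ Finset.univ.filter fun i : Fin m => j.testBit i, x i := by
  rw [maskSum, Finset.sum_filter]

theorem maskSum_add_maskSum {R : Type*} [AddCommMonoid R] {m : ℕ} (x : Fin m → R) {a k : ℕ}
    (h : a &&& k = a) : maskSum x a + maskSum x (k ^^^ a) = maskSum x k := by
  simp only [maskSum, ← Finset.sum_add_distrib]
  refine Finset.sum_congr rfl fun i _ => ?_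
  have := congrArg (Nat.testBit · (i : ℕ)) h
  simp only [Nat.testBit_and, Nat.testBit_xor] at this ⊢
  revert this
  cases a.testBit i <;> cases k.testBit i <;> simp

theorem maskSum_add_smul {m : ℕ} (x y : Fin m → ℝ) (a b : ℝ) (j : ℕ) :
    maskSum (fun i => a * x i + b * y i) j = a * maskSum x j + b * maskSum y j := by
  simp only [maskSum, Finset.mul_sum, ← Finset.sum_add_distrib]
  refine Finset.sum_congr rfl fun i _ => ?_
  split_ifs <;> simp

theorem forall_sum_ne_zero_iff {n : ℕ} {x : Fin (n + 1) → ℝ} (hx : ∑ i, x i = 0) :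
    (∀ I : Finset (Fin (n + 1)), I.Nonempty → I ≠ Finset.univ → ∑ i ∈ I, x i ≠ 0) ↔
      ∀ j, 1 ≤ j → j ≤ 2 ^ n - 1 → maskSum x j ≠ 0 := by
  have hpos : 0 < 2 ^ n := by positivity
  constructor
  · intro h j h1 h2
    rw [maskSum_eq_sum_filter]
    refine h _ ?_ ?_
    · obtain ⟨i, hi⟩ := Nat.exists_testBit_of_ne_zero (x := j) (by omega)
      have hin : i < n := by
        by_contra! hni
        have : j < 2 ^ i := lt_of_lt_of_le (by omega) (Nat.pow_le_pow_right two_pos hni)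
        rw [Nat.testBit_lt_two_pow this] at hi
        exact Bool.false_ne_true hi
      exact ⟨⟨i, by omega⟩, by simpa using hi⟩
    · intro huniv
      have := Finset.mem_univ (Fin.last n)
      rw [← huniv, Finset.mem_filter, Fin.val_last,
        Nat.testBit_lt_two_pow (by omega : j < 2 ^ n)] at this
      exact Bool.false_ne_true this.2
  · intro h
    have key : ∀ I : Finset (Fin (n + 1)), I.Nonempty → Fin.last n ∉ I → ∑ i ∈ I, x i ≠ 0 := by
      intro I hI hlast
      set j := Nat.ofBits fun i : Fin (n + 1) => decide (i ∈ I) with hj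
      have hbit : ∀ i : Fin (n + 1), j.testBit i = decide (i ∈ I) := fun i =>
        Nat.testBit_ofBits_lt _ _ i.2
      have hI_eq : (Finset.univ.filter fun i : Fin (n + 1) => j.testBit i) = I := by
        ext i; simp [hbit]
      have hj1 : 1 ≤ j := by
        obtain ⟨i, hi⟩ := hI
        by_contra! h0
        have := hbit i
        simp [Nat.lt_one_iff.1 h0, hi] at this
      have hj2 : j < 2 ^ n := by
        refine Nat.lt_pow_two_of_testBit _ fun i hi => ?_
        obtain rfl | hi := eq_or_lt_of_le hi
        · simpa [hlast] using hbit (Fin.last n)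
        · exact Nat.testBit_ofBits_ge _ _ hi
      have := h j hj1 (by omega)
      rwa [maskSum_eq_sum_filter, hI_eq] at this
    intro I hI hne
    by_cases hlast : Fin.last n ∈ I
    · have hc := key Iᶜ (by
        rw [Finset.nonempty_iff_ne_empty, Ne, Finset.compl_eq_empty_iff]; exact hne) (by simpa)
      have := Finset.sum_add_sum_compl I x
      intro h0
      rw [h0, hx, zero_add] at this
      exact hc this
    · exact key I hI hlast

/-- The code of the signs of the sums over the nonempty subsets of the first `n` coordinates. -/
noncomputable def signCode {n : ℕ} (x : Fin (n + 1) → ℝ) : ℕ :=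
  code (fun j => decide (0 < maskSum x j)) (2 ^ n - 1)

theorem signCode_eq_signCode_iff {n : ℕ} {x y : Fin (n + 1) → ℝ} :
    signCode x = signCode y ↔
      ∀ j, 1 ≤ j → j ≤ 2 ^ n - 1 → (0 < maskSum x j ↔ 0 < maskSum y j) := by
  simp [signCode, code_eq_code_iff]

/-- The complement in `H0` of the all-subset arrangement. -/
abbrev Complement (m : ℕ) : Type :=
  {x : EuclideanSpace ℝ (Fin m) // (∑ i, x i = 0) ∧
    ∀ I : Finset (Fin m), I.Nonempty → I ≠ Finset.univ → ∑ i ∈ I, x i ≠ 0}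

theorem Complement.maskSum_ne_zero {n : ℕ} (x : Complement (n + 1)) {j : ℕ} (h1 : 1 ≤ j)
    (h2 : j ≤ 2 ^ n - 1) : maskSum (fun i => x.1 i) j ≠ 0 :=
  (forall_sum_ne_zero_iff x.2.1).1 x.2.2 j h1 h2

theorem continuous_signCode {n : ℕ} :
    Continuous fun x : Complement (n + 1) => signCode fun i => x.1 i := by
  rw [← IsLocallyConstant.iff_continuous, IsLocallyConstant.iff_eventually_eq]
  intro x
  have hev : ∀ j ∈ Finset.Icc 1 (2 ^ n - 1), ∀ᶠ y : Complement (n + 1) in nhds x,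
      (0 < maskSum (fun i => y.1 i) j ↔ 0 < maskSum (fun i => x.1 i) j) := by
    intro j hj
    rw [Finset.mem_Icc] at hj
    have hcont : Continuous fun y : Complement (n + 1) => maskSum (fun i => y.1 i) j := by
      simp only [maskSum_eq_sum_filter]
      fun_prop
    obtain h | h := (x.maskSum_ne_zero hj.1 hj.2).lt_or_gt
    · filter_upwards [hcont.continuousAt.eventually_lt continuousAt_const h] with y hy
      exact iff_of_false hy.not_gt h.not_gt
    · filter_upwards [continuousAt_const.eventually_lt hcont.continuousAt h] with y hy
      exact iff_of_true hy h
  filter_upwards [(Filter.eventually_all_finset _).2 hev] with y hy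
  exact signCode_eq_signCode_iff.2 fun j h1 h2 => hy j (Finset.mem_Icc.2 ⟨h1, h2⟩)

theorem isPreconnected_signCode_fiber {n : ℕ} (c : ℕ) :
    IsPreconnected ((fun x : Complement (n + 1) => signCode fun i => x.1 i) ⁻¹' {c}) := by
  refine (Topology.IsInducing.isPreconnected_image
    (f := fun x : Complement (n + 1) => x.1) ⟨rfl⟩).1 (Convex.isPreconnected ?_)
  rintro _ ⟨x, hx, rfl⟩ _ ⟨y, hy, rfl⟩ a b ha hb hab
  have hxy := signCode_eq_signCode_iff.1 (Eq.trans hx (Eq.symm hy))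
  set z : EuclideanSpace ℝ (Fin (n + 1)) := a • x.1 + b • y.1
  have hz : ∀ i, z i = a * x.1 i + b * y.1 i := fun i => by simp [z]
  have hzsum : ∑ i, z i = 0 := by
    simp only [hz, Finset.sum_add_distrib, ← Finset.mul_sum, x.2.1, y.2.1, mul_zero, add_zero]
  have hsign : ∀ j, 1 ≤ j → j ≤ 2 ^ n - 1 → maskSum (fun i => z i) j ≠ 0 ∧
      (0 < maskSum (fun i => z i) j ↔ 0 < maskSum (fun i => x.1 i) j) := by
    intro j h1 h2
    simp only [hz, maskSum_add_smul]
    have hj := hxy j h1 h2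
    obtain h | h := (x.maskSum_ne_zero h1 h2).lt_or_gt
    · have h' := (y.maskSum_ne_zero h1 h2).lt_of_le (not_lt.1 (mt hj.2 h.not_gt))
      have := convex_Iio (𝕜 := ℝ) (0 : ℝ) h h' ha hb hab
      exact ⟨ne_of_lt this, iff_of_false (not_lt_of_gt this) h.not_gt⟩
    · have := convex_Ioi (𝕜 := ℝ) (0 : ℝ) h (hj.1 h) ha hb hab
      exact ⟨ne_of_gt this, iff_of_true this h⟩
  refine ⟨⟨z, hzsum, (forall_sum_ne_zero_iff hzsum).2 fun j h1 h2 => (hsign j h1 h2).1⟩, ?_, rfl⟩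
  refine Eq.trans ?_ hx
  exact signCode_eq_signCode_iff.2 fun j h1 h2 => (hsign j h1 h2).2

theorem numChambersAllSubset_eq_ncard (n : ℕ) :
    numChambersAllSubset (n + 1) =
      (range fun x : Complement (n + 1) => signCode fun i => x.1 i).ncard :=
  natCard_connectedComponents_eq_ncard_range continuous_signCode isPreconnected_signCode_fiber

theorem signCode_mem_consistentCodes {n : ℕ} (x : Complement (n + 1)) :
    signCode (fun i => x.1 i) ∈ consistentCodes (2 ^ n - 1) := by
  refine code_mem_consistentCodes (N := 2 ^ n - 1) ?_ le_rfl
  rintro a b k ha hb hk hak rfl hab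
  have hpos : 0 < 2 ^ n := by positivity
  have hale : a ≤ k := hak ▸ Nat.and_le_right
  have hblt : k ^^^ a < 2 ^ n := Nat.xor_lt_two_pow (by omega) (by omega)
  have hadd := maskSum_add_maskSum (fun i => x.1 i) hak
  have hane := x.maskSum_ne_zero ha (by omega)
  have hbne := x.maskSum_ne_zero hb (by omega)
  rw [decide_eq_decide] at hab ⊢
  rw [← hadd]
  obtain h | h := hane.lt_or_gt
  · have h' := hbne.lt_of_le (not_lt.1 (mt hab.2 h.not_gt))
    exact iff_of_false (by linarith) h.not_gt
  · exact iff_of_true (by linarith [hab.1 h]) h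

/-- The sum of the entries of a list of integers over the binary digits of `j`. -/
def listMaskSum : List ℤ → ℕ → ℤ
  | [], _ => 0
  | a :: l, j => (bif j.testBit 0 then a else 0) + listMaskSum l (j / 2)

theorem listMaskSum_eq_maskSum (l : List ℤ) (j : ℕ) :
    listMaskSum l j = maskSum l.get j := by
  induction l generalizing j with
  | nil => simp [listMaskSum, maskSum]
  | cons a l ih =>
    rw [listMaskSum, ih, maskSum, maskSum]
    erw [Fin.sum_univ_succ]
    simp [Nat.testBit_succ, Bool.cond_eq_ite]

/-- Whether a list of integers is a point of the complement in `H0` of the all-subset arrangement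
in dimension `n + 1`. -/
def IsComplementPoint (n : ℕ) (l : List ℤ) : Bool :=
  l.length == n + 1 && l.sum == 0 &&
    (List.range (2 ^ n - 1)).all fun j => listMaskSum l (j + 1) != 0

/-- The code of the signs of the subset sums of a list of integers. -/
def listSignCode (n : ℕ) (l : List ℤ) : ℕ :=
  code (fun j => decide (0 < listMaskSum l j)) (2 ^ n - 1)

theorem listSignCode_mem_range {n : ℕ} {l : List ℤ} (h : IsComplementPoint n l) :
    listSignCode n l ∈ range fun x : Complement (n + 1) => signCode fun i => x.1 i := by
  simp only [IsComplementPoint, Bool.and_eq_true, beq_iff_eq, List.all_eq_true, List.mem_range,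
    bne_iff_ne] at h
  obtain ⟨⟨hlen, hsum⟩, hne⟩ := h
  set x : Fin (n + 1) → ℝ := fun i => (l.get (i.cast hlen.symm) : ℝ)
  have hmask : ∀ j, maskSum x j = listMaskSum l j := by
    intro j
    rw [listMaskSum_eq_maskSum, maskSum, maskSum, Int.cast_sum]
    refine Fintype.sum_equiv (finCongr hlen.symm) _ _ fun i => ?_
    simp only [x, finCongr_apply, Fin.val_cast]
    split_ifs <;> simp
  have hx : ∑ i, x i = 0 := by
    have : ∑ i, l.get i = 0 := by rw [← hsum, ← List.sum_ofFn, List.ofFn_get]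
    rw [← Int.cast_zero, ← this, Int.cast_sum]
    exact Fintype.sum_equiv (finCongr hlen.symm) _ _ fun i => rfl
  refine ⟨⟨WithLp.toLp 2 x, hx, (forall_sum_ne_zero_iff hx).2 fun j h1 h2 => ?_⟩, ?_⟩
  · have := hne (j - 1) (by omega)
    rw [Nat.sub_add_cancel h1] at this
    rw [hmask]
    exact_mod_cast this
  · refine code_eq_code_iff.2 fun j _ _ => ?_
    rw [decide_eq_decide]
    change 0 < maskSum x j ↔ _
    rw [hmask]
    exact Int.cast_pos

/-- The number whose nonzero binary digits are at the places listed in `l`. -/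
def digitMask : List ℕ → ℕ
  | [] => 0
  | c :: l => 2 ^ c ||| digitMask l

theorem testBit_digitMask {l : List ℕ} {c : ℕ} : (digitMask l).testBit c ↔ c ∈ l := by
  induction l with
  | nil => simp [digitMask]
  | cons a l ih =>
    rw [digitMask, Nat.testBit_or, Bool.or_eq_true, ih, List.mem_cons, Nat.testBit_two_pow,
      decide_eq_true_eq, eq_comm]

/-- The lists obtained from those in `reps` by a permutation and a change of sign. -/
def signedPermutations (reps : List (List ℤ)) : List (List ℤ) :=
  (reps ++ reps.map (List.map Neg.neg)).flatMap List.permutations'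

theorem numChambersAllSubset_eq_length {n : ℕ} (reps : List (List ℤ))
    (hreps : ∀ l ∈ signedPermutations reps, IsComplementPoint n l)
    (hmask : digitMask (consistentCodes (2 ^ n - 1)) =
      digitMask ((signedPermutations reps).map (listSignCode n)))
    (hchain : (consistentCodes (2 ^ n - 1)).IsChain (· < ·)) :
    numChambersAllSubset (n + 1) = (consistentCodes (2 ^ n - 1)).length := by
  have hrange : (range fun x : Complement (n + 1) => signCode fun i => x.1 i) =
      (consistentCodes (2 ^ n - 1)).toFinset := by
    ext c
    rw [Finset.mem_coe, List.mem_toFinset]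
    constructor
    · rintro ⟨x, rfl⟩
      exact signCode_mem_consistentCodes x
    · intro hc
      rw [← testBit_digitMask, hmask, testBit_digitMask, List.mem_map] at hc
      obtain ⟨l, hl, rfl⟩ := hc
      exact listSignCode_mem_range (hreps l hl)
  have hnodup : (consistentCodes (2 ^ n - 1)).Nodup :=
    hchain.pairwise.imp ne_of_lt
  rw [numChambersAllSubset_eq_ncard, hrange, Set.ncard_coe_finset,
    List.toFinset_card_of_nodup hnodup]

theorem numChambersAllSubset_three : numChambersAllSubset 3 = 6 :=
  (numChambersAllSubset_eq_length (n := 2) [[-2, 1, 1]]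
    (by decide +kernel) (by decide +kernel) (by decide +kernel)).trans (by decide +kernel)

theorem numChambersAllSubset_four : numChambersAllSubset 4 = 32 :=
  (numChambersAllSubset_eq_length (n := 3) [[-3, 1, 1, 1], [-3, -1, 2, 2]]
    (by decide +kernel) (by decide +kernel) (by decide +kernel)).trans (by decide +kernel)

theorem numChambersAllSubset_five : numChambersAllSubset 5 = 370 :=
  (numChambersAllSubset_eq_length (n := 4)
    [[-4, 1, 1, 1, 1], [-5, -1, 2, 2, 2], [-4, -1, -1, 3, 3], [-3, -3, 2, 2, 2],
      [-5, -2, 1, 3, 3], [-5, -3, 2, 2, 4]]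
    (by decide +kernel) (by decide +kernel) (by decide +kernel)).trans (by decide +kernel)

end AllSubset

/-- Lemma 5.3 (the cases `m = 3, 4, 5`): the restriction of the all-subset
arrangement to `H0` has `6` chambers for `m = 3`, `32` for `m = 4`, and `370`
for `m = 5`. -/
theorem numChambersAllSubset_values :
    numChambersAllSubset 3 = 6 ∧ numChambersAllSubset 4 = 32 ∧
      numChambersAllSubset 5 = 370 :=
  ⟨AllSubset.numChambersAllSubset_three, AllSubset.numChambersAllSubset_four,
    AllSubset.numChambersAllSubset_five⟩
end

section
/- The number q(m) = |{RP^UF(μ_1,…,μ_m) : μ_1,…,μ_m ∈ ℝ^{m−2} generic}| of ranking patterns of unfolding models of codimension one satisfies q(3) = 3, q(4) = 28 and q(5) = 365. -/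
open scoped BigOperators

/-- Condition (A) for `m` points in a real vector space, with `N` edges. -/
def ConditionA {m : ℕ} (N : ℕ) {E : Type*} [AddCommGroup E] [Module ℝ E]
    (ν : Fin m → E) : Prop :=
  ∀ e : Fin N → Fin m × Fin m,
    (∀ k, (e k).1 ≠ (e k).2) →
    Function.Injective (fun k => s((e k).1, (e k).2)) →
    ((SimpleGraph.fromEdgeSet
        (Set.range fun k => s((e k).1, (e k).2))).IsAcyclic ↔
      LinearIndependent ℝ fun k => ν (e k).1 - ν (e k).2)

/-- Genericity of `μ₁,…,μ_m ∈ ℝ^{m-2}` : condition (A1) and condition (A2) for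
the lifted points `(μⱼ, ‖μⱼ‖²)`. -/
def Generic {m : ℕ} (μ : Fin m → EuclideanSpace ℝ (Fin (m - 2))) : Prop :=
  ConditionA (m - 2) μ ∧
    ConditionA (m - 1)
      (fun j => (μ j, ‖μ j‖ ^ 2) :
        Fin m → EuclideanSpace ℝ (Fin (m - 2)) × ℝ)

/-- The ranking pattern of the unfolding model with ideal objects `μ₁,…,μ_m`. -/
def rankingPatternUF {m n : ℕ} (μ : Fin m → EuclideanSpace ℝ (Fin n)) :
    Set (Equiv.Perm (Fin m)) :=
  {σ | ∃ y : EuclideanSpace ℝ (Fin n),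
    ∀ k l : Fin m, k < l → ‖y - μ (σ k)‖ < ‖y - μ (σ l)‖}

/-- The number of ranking patterns of unfolding models of codimension one. -/
noncomputable def numRankingPatternsUF (m : ℕ) : ℕ :=
  {R : Set (Equiv.Perm (Fin m)) |
    ∃ μ : Fin m → EuclideanSpace ℝ (Fin (m - 2)),
      Generic μ ∧ R = rankingPatternUF μ}.ncard

section Graph

variable {V ι : Type*}

/-- Summation of the coordinates in `I`, as a linear form. -/
def coordSum (I : Finset V) : (V → ℝ) →ₗ[ℝ] ℝ := ∑ i ∈ I, LinearMap.proj i

@[simp]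
theorem coordSum_apply (I : Finset V) (x : V → ℝ) : coordSum I x = ∑ i ∈ I, x i := by
  simp [coordSum]

/-- The vector of an oriented edge, i.e. a column of the oriented incidence matrix. -/
def edgeVec [DecidableEq V] (p : V × V) : V → ℝ := Pi.single p.1 1 - Pi.single p.2 1

theorem coordSum_edgeVec [DecidableEq V] (I : Finset V) (p : V × V) :
    coordSum I (edgeVec p) = (if p.1 ∈ I then 1 else 0) - (if p.2 ∈ I then 1 else 0) := by
  simp [edgeVec, Finset.sum_sub_distrib]

theorem coordSum_eq_zero_of_mem_span [DecidableEq V] {I : Finset V} {s : Set (V × V)}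
    (h : ∀ p ∈ s, p.1 ∈ I ↔ p.2 ∈ I) {x : V → ℝ}
    (hx : x ∈ Submodule.span ℝ (edgeVec '' s)) : coordSum I x = 0 := by
  have : Submodule.span ℝ (edgeVec '' s) ≤ LinearMap.ker (coordSum I) := by
    rw [Submodule.span_le]
    rintro _ ⟨p, hp, rfl⟩
    rw [SetLike.mem_coe, LinearMap.mem_ker, coordSum_edgeVec]
    simp [h p hp]
  exact this hx

theorem edgeVec_mem_span_of_reachable [DecidableEq V] {G : SimpleGraph V} {S : Submodule ℝ (V → ℝ)}
    (h : ∀ x y, G.Adj x y → edgeVec (x, y) ∈ S) {x y : V} (hr : G.Reachable x y) :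
    edgeVec (x, y) ∈ S := by
  obtain ⟨w⟩ := hr
  induction w with
  | nil => simp [edgeVec]
  | cons hadj _ ih =>
    have := S.add_mem (h _ _ hadj) ih
    simpa [edgeVec] using this

/-- The column vectors of the incidence matrix of a simple graph are linearly independent exactly
when the graph is a forest. -/
theorem linearIndependent_edgeVec_iff [Fintype V] [DecidableEq V] (e : ι → V × V)
    (hne : ∀ k, (e k).1 ≠ (e k).2)
    (hinj : Function.Injective fun k => s((e k).1, (e k).2)) :
    LinearIndependent ℝ (fun k => edgeVec (e k)) ↔
      (SimpleGraph.fromEdgeSet (Set.range fun k => s((e k).1, (e k).2))).IsAcyclic := by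
  classical
  set G := SimpleGraph.fromEdgeSet (Set.range fun k => s((e k).1, (e k).2)) with hG
  have hadj : ∀ k, G.Adj (e k).1 (e k).2 := fun k =>
    (SimpleGraph.fromEdgeSet_adj _).2 ⟨⟨k, rfl⟩, hne k⟩
  rw [linearIndependent_iff_notMem_span, SimpleGraph.isAcyclic_iff_forall_adj_isBridge]
  have himage : ∀ k, (fun k => edgeVec (e k)) '' (Set.univ \ {k}) =
      edgeVec '' (e '' (Set.univ \ {k})) := fun k => by rw [Set.image_image]
  constructor
  · intro h v w hvw
    obtain ⟨⟨k, hk⟩, -⟩ := (SimpleGraph.fromEdgeSet_adj _).1 hvw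
    rw [← hk, SimpleGraph.isBridge_iff]
    intro hr
    refine h k (edgeVec_mem_span_of_reachable ?_ hr)
    intro x y hxy
    rw [SimpleGraph.deleteEdges_adj] at hxy
    obtain ⟨⟨⟨l, hl⟩, -⟩, hne'⟩ := hxy
    have hlk : l ≠ k := by
      rintro rfl
      exact hne' hl.symm
    have hmem : edgeVec (e l) ∈
        Submodule.span ℝ ((fun k => edgeVec (e k)) '' (Set.univ \ {k})) :=
      Submodule.subset_span ⟨l, by simpa using hlk, rfl⟩
    rcases Sym2.eq_iff.1 hl with ⟨h1, h2⟩ | ⟨h1, h2⟩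
    · simpa [← h1, ← h2] using hmem
    · have := Submodule.neg_mem _ hmem
      simpa [← h1, ← h2, edgeVec] using this
  · intro h k hk
    have hb := h (hadj k)
    rw [SimpleGraph.isBridge_iff] at hb
    set G' := G.deleteEdges {s((e k).1, (e k).2)}
    let I : Finset V := {x | G'.Reachable (e k).1 x}
    rw [himage] at hk
    have hzero := coordSum_eq_zero_of_mem_span (I := I) ?_ hk
    · rw [coordSum_edgeVec] at hzero
      simp [I, hb] at hzero
    · rintro _ ⟨l, hl, rfl⟩
      have : G'.Adj (e l).1 (e l).2 := by
        rw [SimpleGraph.deleteEdges_adj]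
        refine ⟨hadj l, fun hkl => ?_⟩
        exact hl.2 (hinj hkl)
      simp only [I, Finset.mem_filter, Finset.mem_univ, true_and]
      exact ⟨fun h => h.trans this.reachable, fun h => h.trans this.symm.reachable⟩

/-- A graph with few edges has a nonempty proper vertex set which is a union of components. -/
theorem exists_separating_finset [Fintype V] {N : ℕ} [Nonempty V] (hN : N + 1 < Fintype.card V)
    (e : Fin N → V × V) :
    ∃ I : Finset V, I.Nonempty ∧ I ≠ Finset.univ ∧ ∀ k, (e k).1 ∈ I ↔ (e k).2 ∈ I := by
  classical
  set G := SimpleGraph.fromEdgeSet (Set.range fun k => s((e k).1, (e k).2)) with hG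
  have hnc : ¬ G.Connected := fun hc => by
    have h1 := hc.card_vert_le_card_edgeSet_add_one
    have h2 : Nat.card G.edgeSet ≤ N := by
      have hsub : G.edgeSet ⊆ Set.range fun k => s((e k).1, (e k).2) := by
        simp [hG, SimpleGraph.edgeSet_fromEdgeSet]
      calc Nat.card G.edgeSet ≤ Nat.card (Set.range fun k => s((e k).1, (e k).2)) :=
            Nat.card_mono (Set.finite_range _) hsub
        _ ≤ Nat.card (Fin N) := Finite.card_range_le _
        _ = N := by simp
    rw [Nat.card_eq_fintype_card] at h1
    omega
  have hnp : ¬ G.Preconnected := fun h => hnc ⟨h⟩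
  simp only [SimpleGraph.Preconnected, not_forall] at hnp
  obtain ⟨a, b, hab⟩ := hnp
  refine ⟨Finset.univ.filter (G.Reachable a), ⟨a, by simp⟩, fun h => ?_, fun k => ?_⟩
  · have := Finset.mem_univ b
    rw [← h] at this
    exact hab (by simpa using this)
  · by_cases hk : (e k).1 = (e k).2
    · rw [hk]
    have : G.Adj (e k).1 (e k).2 :=
      (SimpleGraph.fromEdgeSet_adj _).2 ⟨⟨k, rfl⟩, hk⟩
    simp only [Finset.mem_filter, Finset.mem_univ, true_and]
    exact ⟨fun h => h.trans this.reachable, fun h => h.trans this.symm.reachable⟩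

end Graph

section ConditionA

variable {m : ℕ} {E : Type*} [AddCommGroup E] [Module ℝ E]

theorem linearCombination_edgeVec (ν : Fin m → E) (p : Fin m × Fin m) :
    Fintype.linearCombination ℝ ν (edgeVec p) = ν p.1 - ν p.2 := by
  simp [edgeVec, Fintype.linearCombination_apply, sub_smul, Finset.sum_sub_distrib,
    Pi.single_apply, ite_smul]

theorem sum_eq_zero_of_mem_span_edgeVec {ι : Type*} {e : ι → Fin m × Fin m} {x : Fin m → ℝ}
    (hx : x ∈ Submodule.span ℝ (Set.range fun k => edgeVec (e k))) : ∑ i, x i = 0 := by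
  have := coordSum_eq_zero_of_mem_span (I := Finset.univ) (s := Set.range e) (by simp)
    (x := x) (by rwa [← Set.range_comp])
  simpa using this

/-- Affinely independent points satisfy condition (A). -/
theorem conditionA_of_affineIndependent (N : ℕ) (ν : Fin m → E)
    (h : ∀ c : Fin m → ℝ, ∑ i, c i = 0 → ∑ i, c i • ν i = 0 → c = 0) : ConditionA N ν := by
  intro e hne hinj
  rw [← linearIndependent_edgeVec_iff e hne hinj]
  simp_rw [← linearCombination_edgeVec]
  refine (LinearMap.linearIndependent_iff_of_injOn (Fintype.linearCombination ℝ ν) ?_).symm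
  refine LinearMap.injOn_of_disjoint_ker subset_rfl (Submodule.disjoint_def.2 ?_)
  intro x hx hx0
  exact h x (sum_eq_zero_of_mem_span_edgeVec hx) (by
    simpa [Fintype.linearCombination_apply] using hx0)

/-- Points with a unique affine dependency, all of whose proper partial sums are nonzero,
satisfy condition (A). -/
theorem conditionA_of_unique_dependency {N : ℕ} (hN : N + 1 < m) (ν : Fin m → E) (v : Fin m → ℝ)
    (hv : ∀ I : Finset (Fin m), I.Nonempty → I ≠ Finset.univ → ∑ i ∈ I, v i ≠ 0)
    (h : ∀ c : Fin m → ℝ, ∑ i, c i = 0 → ∑ i, c i • ν i = 0 → ∃ t : ℝ, c = t • v) :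
    ConditionA N ν := by
  intro e hne hinj
  rw [← linearIndependent_edgeVec_iff e hne hinj]
  simp_rw [← linearCombination_edgeVec]
  refine (LinearMap.linearIndependent_iff_of_injOn (Fintype.linearCombination ℝ ν) ?_).symm
  refine LinearMap.injOn_of_disjoint_ker subset_rfl (Submodule.disjoint_def.2 ?_)
  intro x hx hx0
  obtain ⟨t, rfl⟩ := h x (sum_eq_zero_of_mem_span_edgeVec hx) (by
    simpa [Fintype.linearCombination_apply] using hx0)
  have : Nonempty (Fin m) := ⟨⟨0, by omega⟩⟩
  obtain ⟨I, hI, hI', hIe⟩ := exists_separating_finset (by simpa using hN) e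
  have hsum := coordSum_eq_zero_of_mem_span (I := I) (s := Set.range e)
    (by rintro _ ⟨k, rfl⟩; exact hIe k) (x := t • v) (by rwa [← Set.range_comp])
  rw [map_smul, coordSum_apply, smul_eq_mul, mul_eq_zero] at hsum
  rw [hsum.resolve_right (hv I hI hI'), zero_smul]

theorem ConditionA.linearIndependent_star {N : ℕ} {ν : Fin m → E} (h : ConditionA N ν)
    (R : Finset (Fin m)) (hR : R.card + N = m) (r : Fin m → Fin m) (hr : ∀ i, r i ∈ R) :
    LinearIndependent ℝ fun x : {x // x ∉ R} => ν x - ν (r x) := by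
  have hcard : Fintype.card {x // x ∉ R} = N := by
    rw [Fintype.card_subtype_compl, Fintype.card_fin, Fintype.card_coe]
    omega
  let f : Fin N ≃ {x // x ∉ R} := (Fintype.equivFinOfCardEq hcard).symm
  let e : Fin N → Fin m × Fin m := fun k => (f k, r (f k))
  have hne : ∀ k, (e k).1 ≠ (e k).2 := fun k (hk : (f k : Fin m) = r (f k)) =>
    (f k).2 (hk ▸ hr (f k))
  have hinj : Function.Injective fun k => s((e k).1, (e k).2) := by
    intro k l hkl
    rcases Sym2.eq_iff.1 hkl with ⟨h1, -⟩ | ⟨h1, -⟩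
    · exact f.injective (Subtype.ext h1)
    · have h1 : (f k : Fin m) = r (f l) := h1
      exact absurd (h1 ▸ hr (f l)) (f k).2
  have hli : LinearIndependent ℝ fun k => edgeVec (e k) := by
    rw [linearIndependent_iff_notMem_span]
    intro k hk
    have hz := coordSum_eq_zero_of_mem_span (I := {(f k : Fin m)})
      (s := e '' (Set.univ \ {k})) ?_ (x := edgeVec (e k)) (by rwa [Set.image_image])
    · rw [coordSum_edgeVec] at hz
      have : r (f k) ≠ f k := fun h => (f k).2 (h ▸ hr (f k))
      simp [e, this] at hz
    · rintro _ ⟨l, hl, rfl⟩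
      have h1 : (f l : Fin m) ≠ f k := fun h => hl.2 (f.injective (Subtype.ext h))
      have h2 : r (f l) ≠ f k := fun h => (f k).2 (h ▸ hr (f l))
      simp [e, h1, h2]
  have := (h e hne hinj).1 ((linearIndependent_edgeVec_iff e hne hinj).1 hli)
  exact (linearIndependent_equiv f).1 this

theorem ConditionA.eq_zero_of_partition {N : ℕ} {ν : Fin m → E} (h : ConditionA N ν)
    (R : Finset (Fin m)) (hR : R.card + N = m) (r : Fin m → Fin m) (hr : ∀ i, r i ∈ R)
    (hrR : ∀ i ∈ R, r i = i) {c : Fin m → ℝ}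
    (hc : ∀ j ∈ R, ∑ i with r i = j, c i = 0) (hcν : ∑ i, c i • ν i = 0) : c = 0 := by
  have hsum : ∑ i, c i • ν (r i) = 0 := by
    rw [← Finset.sum_fiberwise_of_maps_to (fun i _ => hr i)]
    refine Finset.sum_eq_zero fun j hj => ?_
    rw [Finset.sum_congr rfl (g := fun i => c i • ν j), ← Finset.sum_smul, hc j hj, zero_smul]
    intro i hi
    rw [(Finset.mem_filter.1 hi).2]
  have hdiff : ∑ i, c i • (ν i - ν (r i)) = 0 := by
    simp_rw [smul_sub, Finset.sum_sub_distrib, hcν, hsum, sub_zero]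
  have hout : ∀ i ∉ R, c i = 0 := by
    have hli := Fintype.linearIndependent_iff.1 (h.linearIndependent_star R hR r hr)
      (fun x => c x) ?_
    · exact fun i hi => hli ⟨i, hi⟩
    · rw [← Finset.sum_subtype (Finset.univ.filter (· ∉ R)) (by simp)
        (fun i => c i • (ν i - ν (r i))), Finset.sum_filter_of_ne, hdiff]
      intro i _ hi hiR
      exact hi (by simp [hrR i hiR])
  funext j
  by_cases hj : j ∈ R
  · have := hc j hj
    rwa [Finset.sum_eq_single j] at this
    · intro i hi hij
      refine hout i fun hiR => hij ?_
      rw [← hrR i hiR, (Finset.mem_filter.1 hi).2]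
    · intro hn
      simp [hrR j hj] at hn
  · exact hout j hj

/-- Condition (A) with the maximal number of edges implies affine independence. -/
theorem ConditionA.affineIndependent {N : ℕ} (hN : 1 + N = m) {ν : Fin m → E}
    (h : ConditionA N ν) {c : Fin m → ℝ} (hc : ∑ i, c i = 0) (hcν : ∑ i, c i • ν i = 0) :
    c = 0 := by
  let i₀ : Fin m := ⟨0, by omega⟩
  refine h.eq_zero_of_partition {i₀} (by simpa using hN) (fun _ => i₀) (by simp)
    (by simp) ?_ hcν
  simpa using hc

/-- Condition (A) with one edge less than the maximum forces proper partial sums of an affine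
dependency to be nonzero. -/
theorem ConditionA.partial_sum_ne_zero {N : ℕ} (hN : 2 + N = m) {ν : Fin m → E}
    (h : ConditionA N ν) {c : Fin m → ℝ} (hc : ∑ i, c i = 0) (hcν : ∑ i, c i • ν i = 0)
    (hc0 : c ≠ 0) (I : Finset (Fin m)) (hI : I.Nonempty) (hI' : I ≠ Finset.univ) :
    ∑ i ∈ I, c i ≠ 0 := by
  intro hIc
  obtain ⟨a, ha⟩ := hI
  obtain ⟨b, hb⟩ : ∃ b, b ∉ I := by
    by_contra! hall
    exact hI' (Finset.eq_univ_iff_forall.2 hall)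
  have hab : a ≠ b := by
    rintro rfl
    exact hb ha
  refine hc0 (h.eq_zero_of_partition {a, b} (by rw [Finset.card_pair hab, hN])
    (fun i => if i ∈ I then a else b) ?_ ?_ ?_ hcν)
  · intro i
    by_cases hi : i ∈ I <;> simp [hi]
  · simp [ha, hb]
  · have hcompl : ∑ i ∈ Iᶜ, c i = 0 := by
      have := Finset.sum_add_sum_compl I c
      linarith
    intro j hj
    rcases Finset.mem_insert.1 hj with rfl | hj
    · rw [← hIc]
      refine Finset.sum_congr ?_ fun _ _ => rfl
      ext i
      by_cases hi : i ∈ I <;> simp [hi, hab.symm]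
    · rw [Finset.mem_singleton.1 hj, ← hcompl]
      refine Finset.sum_congr ?_ fun _ _ => rfl
      ext i
      by_cases hi : i ∈ I <;> simp [hi, hab]

end ConditionA

section Dependency

open scoped InnerProductSpace

/-- `v` is the affine dependency of the affinely spanning points `μ`, normalized on the
squared norms. -/
structure IsDependency {m n : ℕ} (μ : Fin m → EuclideanSpace ℝ (Fin n)) (v : Fin m → ℝ) :
    Prop where
  sum_eq : ∑ i, v i = 0
  sum_smul : ∑ i, v i • μ i = 0
  sum_sq : ∑ i, v i * ‖μ i‖ ^ 2 = 1
  spanning : ∀ (y : EuclideanSpace ℝ (Fin n)) (c : ℝ), (∀ i, ⟪μ i, y⟫_ℝ = c) → y = 0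

variable {m n : ℕ} {μ : Fin m → EuclideanSpace ℝ (Fin n)} {v : Fin m → ℝ}

theorem exists_isDependency (hn : n + 2 = m)
    (h : ∀ c : Fin m → ℝ, ∑ i, c i = 0 → ∑ i, c i • (μ i, ‖μ i‖ ^ 2) = 0 → c = 0) :
    ∃ v, IsDependency μ v := by
  let T : (Fin m → ℝ) →ₗ[ℝ] ℝ × EuclideanSpace ℝ (Fin n) × ℝ :=
    (coordSum Finset.univ).prod (Fintype.linearCombination ℝ fun i => (μ i, ‖μ i‖ ^ 2))
  have hT : ∀ c, T c = (∑ i, c i, ∑ i, c i • μ i, ∑ i, c i * ‖μ i‖ ^ 2) := fun c => by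
    simp [T, Fintype.linearCombination_apply, Prod.ext_iff, Prod.fst_sum, Prod.snd_sum]
  have hinj : Function.Injective T := by
    rw [← LinearMap.ker_eq_bot, LinearMap.ker_eq_bot']
    intro c hc
    have hc1 : coordSum Finset.univ c = 0 := congrArg Prod.fst hc
    have hc2 : Fintype.linearCombination ℝ (fun i => (μ i, ‖μ i‖ ^ 2)) c = 0 :=
      congrArg Prod.snd hc
    exact h c (by simpa using hc1) (by rwa [Fintype.linearCombination_apply] at hc2)
  have hsurj : Function.Surjective T := by
    refine (LinearMap.injective_iff_surjective_of_finrank_eq_finrank ?_).1 hinj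
    simp
    omega
  obtain ⟨v, hv⟩ := hsurj (0, 0, 1)
  rw [hT] at hv
  simp only [Prod.mk.injEq] at hv
  refine ⟨v, hv.1, hv.2.1, hv.2.2, fun y c hy => ?_⟩
  obtain ⟨w, hw⟩ := hsurj (0, y, 0)
  rw [hT] at hw
  simp only [Prod.mk.injEq] at hw
  have : ⟪y, y⟫_ℝ = 0 := by
    nth_rewrite 1 [← hw.2.1]
    simp_rw [sum_inner, inner_smul_left, hy, ← Finset.sum_mul]
    simp [hw.1]
  exact inner_self_eq_zero.1 this

theorem IsDependency.ne_zero (h : IsDependency μ v) : v ≠ 0 := by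
  rintro rfl
  simpa using h.sum_sq

theorem IsDependency.sum_mul_eq_zero (h : IsDependency μ v) (y : EuclideanSpace ℝ (Fin n))
    (c : ℝ) : ∑ i, v i * (⟪μ i, y⟫_ℝ + c) = 0 := by
  have h1 : ∑ i, v i * ⟪μ i, y⟫_ℝ = 0 := by
    have := congrArg (fun x => ⟪x, y⟫_ℝ) h.sum_smul
    simpa [sum_inner, inner_smul_left] using this
  simp_rw [mul_add, Finset.sum_add_distrib, ← Finset.sum_mul, h1, h.sum_eq]
  simp

/-- The affine functions on the points are exactly the vectors orthogonal to the dependency. -/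
theorem IsDependency.exists_affine (hn : n + 2 = m) (h : IsDependency μ v) {z : Fin m → ℝ}
    (hz : ∑ i, v i * z i = 0) :
    ∃ (y : EuclideanSpace ℝ (Fin n)) (c : ℝ), ∀ i, z i = ⟪μ i, y⟫_ℝ + c := by
  let L : EuclideanSpace ℝ (Fin n) × ℝ →ₗ[ℝ] (Fin m → ℝ) :=
    LinearMap.pi fun i => ((innerₛₗ ℝ (μ i)).comp (LinearMap.fst ℝ _ _)) + LinearMap.snd ℝ _ _
  have hL : ∀ p i, L p i = ⟪μ i, p.1⟫_ℝ + p.2 := fun p i => by simp [L]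
  let φ : (Fin m → ℝ) →ₗ[ℝ] ℝ := Fintype.linearCombination ℝ v
  have hφ : ∀ x, φ x = ∑ i, v i * x i := fun x => by
    simp [φ, Fintype.linearCombination_apply, mul_comm]
  have hinj : LinearMap.ker L = ⊥ := by
    rw [LinearMap.ker_eq_bot']
    rintro ⟨y, c⟩ hp
    have hp' : ∀ i, ⟪μ i, y⟫_ℝ + c = 0 := fun i => by rw [← hL (y, c) i, hp]; rfl
    have hy : y = 0 := h.spanning y (-c) fun i => by linarith [hp' i]
    have hc := hp' ⟨0, by omega⟩
    simp only [hy, inner_zero_right, zero_add] at hc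
    simp [hy, hc]
  have hφ0 : φ ≠ 0 := fun h0 => h.ne_zero <| by
    funext i
    have := LinearMap.congr_fun h0 (Pi.single i 1)
    simpa [hφ, Pi.single_apply] using this
  have hle : LinearMap.range L ≤ LinearMap.ker φ := by
    rintro _ ⟨p, rfl⟩
    rw [LinearMap.mem_ker, hφ]
    simp_rw [hL]
    exact h.sum_mul_eq_zero _ _
  have heq : LinearMap.range L = LinearMap.ker φ := by
    refine Submodule.eq_of_le_of_finrank_eq hle ?_
    have h1 := LinearMap.finrank_range_of_inj (LinearMap.ker_eq_bot.1 hinj)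
    have h2 := Module.Dual.finrank_ker_add_one_of_ne_zero hφ0
    simp at h1 h2
    omega
  have hmem : z ∈ LinearMap.range L := by
    rw [heq, LinearMap.mem_ker, hφ, hz]
  obtain ⟨p, rfl⟩ := hmem
  exact ⟨p.1, p.2, hL p⟩

theorem IsDependency.eq_smul (hn : n + 2 = m) (h : IsDependency μ v) {c : Fin m → ℝ}
    (hc : ∑ i, c i = 0) (hcμ : ∑ i, c i • μ i = 0) : ∃ t : ℝ, c = t • v := by
  obtain ⟨j, hj⟩ := Function.ne_iff.1 h.ne_zero
  have hj : v j ≠ 0 := hj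
  refine ⟨c j / v j, funext fun i => ?_⟩
  let z : Fin m → ℝ := Pi.single i (v j) - Pi.single j (v i)
  obtain ⟨y, d, hyd⟩ := h.exists_affine hn (z := z) (by
    simp [z, mul_sub, Finset.sum_sub_distrib, Pi.single_apply]; ring)
  have h1 : ∑ k, c k * z k = c i * v j - c j * v i := by
    simp [z, mul_sub, Finset.sum_sub_distrib, Pi.single_apply]
  have h2 : ∑ k, c k * z k = 0 := by
    have := congrArg (fun x => ⟪x, y⟫_ℝ) hcμ
    simp only [sum_inner, inner_smul_left, inner_zero_left] at this
    simp_rw [hyd, mul_add, Finset.sum_add_distrib, ← Finset.sum_mul, hc]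
    simpa using this
  rw [Pi.smul_apply, smul_eq_mul]
  field_simp
  linarith

theorem IsDependency.exists_two_pos (h : IsDependency μ v) :
    ∃ a b, a ≠ b ∧ 0 < v a ∧ 0 < v b := by
  obtain ⟨a, -, ha⟩ := Finset.exists_pos_of_sum_zero_of_exists_nonzero v h.sum_eq (by
    obtain ⟨j, hj⟩ := Function.ne_iff.1 h.ne_zero
    exact ⟨j, Finset.mem_univ j, hj⟩)
  by_contra! hno
  have hneg : ∀ b, a ≠ b → v b ≤ 0 := fun b hab => hno a b hab ha
  have h1 : ∑ i, v i * ‖μ i - μ a‖ ^ 2 = 1 := by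
    have h2 := h.sum_mul_eq_zero (-(2 : ℝ) • μ a) (‖μ a‖ ^ 2)
    rw [← h.sum_sq, ← sub_eq_zero, ← Finset.sum_sub_distrib, ← h2]
    refine Finset.sum_congr rfl fun i _ => ?_
    rw [norm_sub_sq_real, inner_smul_right]
    ring
  have h2 : ∑ i, v i * ‖μ i - μ a‖ ^ 2 ≤ 0 := by
    refine Finset.sum_nonpos fun i _ => ?_
    by_cases hi : a = i
    · simp [hi]
    · exact mul_nonpos_of_nonpos_of_nonneg (hneg i hi) (by positivity)
  linarith

theorem Generic.exists_isDependency (hm : 2 ≤ m)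
    {μ : Fin m → EuclideanSpace ℝ (Fin (m - 2))} (h : Generic μ) :
    ∃ v, IsDependency μ v ∧
      ∀ I : Finset (Fin m), I.Nonempty → I ≠ Finset.univ → ∑ i ∈ I, v i ≠ 0 := by
  obtain ⟨v, hv⟩ := _root_.exists_isDependency (μ := μ) (by omega)
    (fun c hc hc' => h.2.affineIndependent (by omega) hc hc')
  exact ⟨v, hv, h.1.partial_sum_ne_zero (by omega) hv.sum_eq hv.sum_smul hv.ne_zero⟩

theorem IsDependency.generic (hm : 2 ≤ m) {μ : Fin m → EuclideanSpace ℝ (Fin (m - 2))}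
    (h : IsDependency μ v)
    (hv : ∀ I : Finset (Fin m), I.Nonempty → I ≠ Finset.univ → ∑ i ∈ I, v i ≠ 0) :
    Generic μ := by
  refine ⟨conditionA_of_unique_dependency (by omega) μ v hv fun c hc hcμ =>
    h.eq_smul (by omega) hc hcμ, conditionA_of_affineIndependent _ _ fun c hc hcμ => ?_⟩
  obtain ⟨h1, h2⟩ : ∑ i, c i • μ i = 0 ∧ ∑ i, c i * ‖μ i‖ ^ 2 = 0 := by
    simpa [Prod.ext_iff, Prod.fst_sum, Prod.snd_sum] using hcμ
  obtain ⟨t, rfl⟩ := h.eq_smul (by omega) hc h1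
  simp_rw [Pi.smul_apply, smul_eq_mul, mul_assoc, ← Finset.mul_sum, h.sum_sq] at h2
  rw [mul_one] at h2
  rw [h2, zero_smul]

end Dependency

section Existence

theorem exists_quadratic_pos (A B : ℝ) {C : ℝ} (hC : 0 < C) :
    ∃ t : ℝ, 0 ≤ t ∧ 0 < A + B * t + C * t ^ 2 := by
  have hB := neg_abs_le B
  have hA := neg_abs_le A
  have hB' := abs_nonneg B
  have hA' := abs_nonneg A
  refine ⟨(|A| + |B|) / C + 1, by positivity, ?_⟩
  set t := (|A| + |B|) / C + 1 with ht
  have hCt : C * t = |A| + |B| + C := by rw [ht]; field_simp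
  have ht1 : 1 ≤ t := by
    have : 0 ≤ (|A| + |B|) / C := by positivity
    linarith
  have h1 : C * t ^ 2 = (|A| + |B| + C) * t := by rw [← hCt]; ring
  rw [h1]
  nlinarith [mul_nonneg hA' (sub_nonneg.2 ht1), mul_nonneg (by linarith : 0 ≤ B + |B|)
    (by linarith : 0 ≤ t), mul_pos hC (by linarith : 0 < t)]

/-- Every zero-sum vector with at least two positive entries is the normalized
dependency of some spanning points. -/
theorem exists_isDependency_of_two_pos {m n : ℕ} (hn : n + 2 = m) {v : Fin m → ℝ}
    (hsum : ∑ i, v i = 0) {a b c : Fin m} (hab : a ≠ b) (hac : a ≠ c)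
    (hbc : b ≠ c) (ha : 0 < v a) (hb : 0 < v b) :
    ∃ μ : Fin m → EuclideanSpace ℝ (Fin n), IsDependency μ v := by
  let f : (Fin m → ℝ) →ₗ[ℝ] ℝ × ℝ :=
    (Fintype.linearCombination ℝ v).prod (LinearMap.proj c)
  have hf : ∀ x, f x = (∑ i, v i * x i, x c) := fun x => by
    simp [f, Fintype.linearCombination_apply, mul_comm]
  have hsurj : LinearMap.range f = ⊤ := by
    rw [LinearMap.range_eq_top]
    rintro ⟨p, q⟩
    refine ⟨Pi.single a ((p - v c * q) / v a) + Pi.single c q, ?_⟩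
    rw [hf]
    simp [mul_add, Finset.sum_add_distrib, Pi.single_apply, hac.symm]
    field_simp
    ring
  have hdim : Module.finrank ℝ (LinearMap.ker f) = n := by
    have := LinearMap.finrank_range_add_finrank_ker f
    rw [hsurj] at this
    simp at this
    omega
  let B := Module.finBasisOfFinrankEq ℝ (LinearMap.ker f) hdim
  have hker : ∀ x : LinearMap.ker f, ∑ i, v i * (x : Fin m → ℝ) i = 0 ∧ (x : Fin m → ℝ) c = 0 :=
    fun x => by
      have h0 := x.2
      rw [LinearMap.mem_ker, hf] at h0
      exact Prod.mk.inj h0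
  let u : LinearMap.ker f := ⟨Pi.single a (v a)⁻¹ - Pi.single b (v b)⁻¹, by
    rw [LinearMap.mem_ker, hf]
    simp [mul_sub, Finset.sum_sub_distrib, Pi.single_apply, hac.symm, hbc.symm,
      ha.ne', hb.ne']⟩
  have hu0 : u ≠ 0 := fun h0 => by
    have := congrFun (congrArg Subtype.val h0) a
    simp [u, hab, ha.ne'] at this
  have hQu : 0 < ∑ i, v i * (u : Fin m → ℝ) i ^ 2 := by
    have : ∑ i, v i * (u : Fin m → ℝ) i ^ 2 = (v a)⁻¹ + (v b)⁻¹ := by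
      have hsq : ∀ i, v i * (u : Fin m → ℝ) i ^ 2 =
          (if i = a then (v a)⁻¹ else 0) + (if i = b then (v b)⁻¹ else 0) := fun i => by
        by_cases hia : i = a
        · subst hia
          simp [u, hab]
          field_simp
        · by_cases hib : i = b
          · subst hib
            simp [u, hab.symm]
            field_simp
          · simp [u, hia, hib]
      simp_rw [hsq, Finset.sum_add_distrib]
      simp
    rw [this]
    positivity
  let γ : Fin n → ℝ := fun k => B.repr u k
  have hγ : 0 < ∑ k, γ k ^ 2 := by
    obtain ⟨k, hk⟩ : ∃ k, γ k ≠ 0 := by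
      by_contra! hall
      refine hu0 (B.repr.map_eq_zero_iff.1 (Finsupp.ext hall))
    exact Finset.sum_pos' (fun i _ => sq_nonneg _) ⟨k, Finset.mem_univ k, by positivity⟩
  obtain ⟨t, ht, htpos⟩ := exists_quadratic_pos
    (∑ k, ∑ i, v i * (B k : Fin m → ℝ) i ^ 2)
    (∑ k, ∑ i, v i * (2 * (B k : Fin m → ℝ) i * γ k * (u : Fin m → ℝ) i))
    (mul_pos hγ hQu)
  let M : Fin n → LinearMap.ker f := fun k => B k + (t * γ k) • u
  set S := ∑ k, ∑ i, v i * (M k : Fin m → ℝ) i ^ 2 with hS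
  have hSpos : 0 < S := by
    convert htpos using 1
    rw [Finset.sum_mul_sum, Finset.sum_mul, Finset.sum_mul, hS, ← Finset.sum_add_distrib,
      ← Finset.sum_add_distrib]
    refine Finset.sum_congr rfl fun k _ => ?_
    rw [Finset.sum_mul, Finset.sum_mul, ← Finset.sum_add_distrib, ← Finset.sum_add_distrib]
    refine Finset.sum_congr rfl fun i _ => ?_
    simp [M]
    ring
  have hMindep : ∀ y : Fin n → ℝ, ∑ k, y k • M k = 0 → y = 0 := fun y hy => by
    set s := ∑ k, y k * γ k with hs
    have hcoord : ∀ l, y l + t * s * γ l = 0 := fun l => by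
      have h0 : ∑ k, y k • M k = ∑ k, y k • B k + (t * s) • u := by
        simp_rw [M, smul_add, Finset.sum_add_distrib, smul_smul, ← Finset.sum_smul, hs,
          Finset.mul_sum]
        congr 2
        exact Finset.sum_congr rfl fun k _ => by ring
      rw [hy] at h0
      have h1 := congrArg (fun x => B.repr x l) h0
      simp only [map_zero, map_add, map_smul, Finsupp.coe_zero, Pi.zero_apply, Finsupp.coe_add,
        Pi.add_apply, Finsupp.coe_smul, Pi.smul_apply, smul_eq_mul, B.repr_sum_self] at h1
      exact h1.symm
    have h2 : ∑ l, y l ^ 2 + t * s ^ 2 = 0 := by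
      have : ∑ l, y l * (y l + t * s * γ l) = 0 := by simp [hcoord]
      rw [← this, sq s]
      nth_rewrite 2 [hs]
      rw [Finset.mul_sum, Finset.mul_sum, ← Finset.sum_add_distrib]
      exact Finset.sum_congr rfl fun k _ => by ring
    have h3 : ∑ l, y l ^ 2 = 0 := le_antisymm
      (by nlinarith [mul_nonneg ht (sq_nonneg s)]) (Finset.sum_nonneg fun i _ => sq_nonneg _)
    funext l
    have := (Finset.sum_eq_zero_iff_of_nonneg fun i _ => sq_nonneg (y i)).1 h3 l
      (Finset.mem_univ l)
    simpa using this
  have hr : (√S)⁻¹ ≠ 0 := inv_ne_zero (Real.sqrt_pos.2 hSpos).ne'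
  refine ⟨fun i => WithLp.toLp 2 fun k => (√S)⁻¹ * (M k : Fin m → ℝ) i, hsum, ?_, ?_, ?_⟩
  · ext k
    have := (hker (M k)).1
    simp only [WithLp.ofLp_sum, WithLp.ofLp_smul, Finset.sum_apply, Pi.smul_apply, smul_eq_mul,
      WithLp.ofLp_zero, Pi.zero_apply]
    rw [← mul_zero (√S)⁻¹, ← this, Finset.mul_sum]
    exact Finset.sum_congr rfl fun i _ => by ring
  · have : ∀ i, v i * ‖(WithLp.toLp 2 fun k => (√S)⁻¹ * (M k : Fin m → ℝ) i :
        EuclideanSpace ℝ (Fin n))‖ ^ 2 = S⁻¹ * ∑ k, v i * (M k : Fin m → ℝ) i ^ 2 := fun i => by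
      rw [EuclideanSpace.real_norm_sq_eq, Finset.mul_sum, Finset.mul_sum]
      refine Finset.sum_congr rfl fun k _ => ?_
      simp only [mul_pow, inv_pow, Real.sq_sqrt hSpos.le]
      ring
    rw [Finset.sum_congr rfl fun i _ => this i, ← Finset.mul_sum, Finset.sum_comm, ← hS,
      inv_mul_cancel₀ hSpos.ne']
  · intro y d hy
    have hinner : ∀ i, (√S)⁻¹ * ∑ k, y k * (M k : Fin m → ℝ) i = d := fun i => by
      rw [← hy i, PiLp.inner_apply, Finset.mul_sum]
      refine Finset.sum_congr rfl fun k _ => ?_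
      simp
      ring
    have hd : d = 0 := by
      rw [← hinner c]
      simp [(hker (M _)).2]
    have hy0 := hMindep y (Subtype.ext (funext fun i => by
      have := hinner i
      rw [hd, mul_eq_zero] at this
      simpa using this.resolve_left hr))
    ext k
    exact congrFun hy0 k

end Existence

section RankingPattern

variable {m : ℕ}

/-- The elements at position `k` or later in the ranking `σ`. -/
def topSet (σ : Equiv.Perm (Fin m)) (k : Fin m) : Finset (Fin m) :=
  (Finset.Ici k).map σ.toEmbedding

theorem mem_topSet {σ : Equiv.Perm (Fin m)} {k i : Fin m} :
    i ∈ topSet σ k ↔ k ≤ σ.symm i := by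
  simp [topSet, Finset.mem_map_equiv]

theorem sum_topSet (σ : Equiv.Perm (Fin m)) (k : Fin m) (v : Fin m → ℝ) :
    ∑ i ∈ topSet σ k, v i = ∑ l, if k ≤ l then v (σ l) else 0 := by
  rw [topSet, Finset.sum_map, ← Finset.sum_filter]
  refine Finset.sum_congr ?_ fun _ _ => rfl
  ext
  simp

/-- The index sets on which `v` has a positive partial sum. -/
def posSets (v : Fin m → ℝ) : Set (Finset (Fin m)) := {I | 0 < ∑ i ∈ I, v i}

/-- The rankings having a top set in `P`. -/
def rankingsMeeting (P : Set (Finset (Fin m))) : Set (Equiv.Perm (Fin m)) :=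
  {σ | ∃ k, topSet σ k ∈ P}

theorem sum_mul_nonpos_of_monotone {n : ℕ} (a x : Fin (n + 1) → ℝ) (hx : Monotone x)
    (ha : ∀ k, ∑ l, (if k ≤ l then a l else 0) ≤ 0) : ∑ l, a l * (x l - x 0) ≤ 0 := by
  induction n with
  | zero => simp
  | succ n ih =>
    have htail : ∀ k, ∑ l, (if k ≤ l then a (Fin.succ l) else 0) ≤ 0 := fun k => by
      have := ha k.succ
      rw [Fin.sum_univ_succ] at this
      simpa [Fin.le_zero_iff] using this
    have h1 := ih (fun l => a l.succ) (fun l => x l.succ)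
      (hx.comp (Fin.strictMono_succ).monotone) htail
    have h2 : ∑ l : Fin (n + 1), a l.succ ≤ 0 := by simpa using htail 0
    have h3 : x 0 ≤ x (Fin.succ 0) := hx (Fin.zero_le _)
    rw [Fin.sum_univ_succ]
    have h4 : ∑ l : Fin (n + 1), a l.succ * (x l.succ - x 0) =
        ∑ l : Fin (n + 1), a l.succ * (x l.succ - x (Fin.succ 0)) +
          (∑ l : Fin (n + 1), a l.succ) * (x (Fin.succ 0) - x 0) := by
      rw [Finset.sum_mul, ← Finset.sum_add_distrib]
      exact Finset.sum_congr rfl fun l _ => by ring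
    rw [h4]
    nlinarith [mul_nonneg (neg_nonneg.2 h2) (sub_nonneg.2 h3)]

/-- A tail with positive sum yields an increasing vector of positive weighted sum. -/
theorem exists_strictMono_sum_mul_eq_one (a : Fin m → ℝ) (k : Fin m)
    (hk : 0 < ∑ l, if k ≤ l then a l else 0) :
    ∃ x : Fin m → ℝ, StrictMono x ∧ ∑ l, a l * x l = 1 := by
  set T := ∑ l, if k ≤ l then a l else 0 with hT
  set B := ∑ l : Fin m, a l * (l : ℝ) with hB
  have hBabs := neg_abs_le B
  have hBnn := abs_nonneg B
  set ε := T / (2 * (|B| + 1)) with hε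
  have hεpos : 0 < ε := by positivity
  have hεB : ε * (2 * (|B| + 1)) = T := by rw [hε]; field_simp
  have hpos : 0 < T + ε * B := by nlinarith
  have hsum : ∑ l : Fin m, a l * ((if k ≤ l then 1 else 0) + ε * (l : ℝ)) = T + ε * B := by
    rw [hT, hB, Finset.mul_sum, ← Finset.sum_add_distrib]
    refine Finset.sum_congr rfl fun l _ => ?_
    split_ifs <;> ring
  refine ⟨fun l => (T + ε * B)⁻¹ * ((if k ≤ l then 1 else 0) + ε * (l : ℝ)), ?_, ?_⟩
  · intro i j hij
    refine mul_lt_mul_of_pos_left (add_lt_add_of_le_of_lt ?_ ?_) (inv_pos.2 hpos)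
    · split_ifs with h1 h2
      · exact le_rfl
      · exact absurd (h1.trans hij.le) h2
      · exact zero_le_one
      · exact le_rfl
    · exact mul_lt_mul_of_pos_left (by exact_mod_cast hij) hεpos
  · simp_rw [mul_left_comm (a _), ← Finset.mul_sum, hsum]
    exact inv_mul_cancel₀ hpos.ne'

open scoped InnerProductSpace in
theorem IsDependency.rankingPatternUF_eq {n : ℕ} (hn : n + 2 = m)
    {μ : Fin m → EuclideanSpace ℝ (Fin n)} {v : Fin m → ℝ} (h : IsDependency μ v) :
    rankingPatternUF μ = rankingsMeeting (posSets v) := by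
  subst hn
  ext σ
  constructor
  · rintro ⟨y, hy⟩
    by_contra hno
    have hno : ∀ k, ∑ l, (if k ≤ l then v (σ l) else 0) ≤ 0 := fun k => by
      rw [← sum_topSet]
      exact not_lt.1 fun hk => hno ⟨k, hk⟩
    have hmono : Monotone fun l => ‖y - μ (σ l)‖ ^ 2 :=
      StrictMono.monotone fun i j hij => pow_lt_pow_left₀ (hy i j hij) (norm_nonneg _) two_ne_zero
    have h1 := sum_mul_nonpos_of_monotone (fun l => v (σ l)) _ hmono hno
    have h2 : ∑ l, v (σ l) * (‖y - μ (σ l)‖ ^ 2 - ‖y - μ (σ 0)‖ ^ 2) =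
        ∑ i, v i * (‖y - μ i‖ ^ 2 - ‖y - μ (σ 0)‖ ^ 2) :=
      Equiv.sum_comp σ fun i => v i * (‖y - μ i‖ ^ 2 - ‖y - μ (σ 0)‖ ^ 2)
    have h3 := h.sum_mul_eq_zero (-(2 : ℝ) • y) (‖y‖ ^ 2 - ‖y - μ (σ 0)‖ ^ 2)
    have h4 : ∑ i, v i * (‖y - μ i‖ ^ 2 - ‖y - μ (σ 0)‖ ^ 2) = 1 := by
      rw [← h.sum_sq, ← sub_eq_zero, ← Finset.sum_sub_distrib, ← h3]
      refine Finset.sum_congr rfl fun i _ => ?_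
      rw [norm_sub_sq_real, inner_smul_right, real_inner_comm]
      ring
    linarith
  · rintro ⟨k, hk⟩
    have hk : 0 < ∑ i ∈ topSet σ k, v i := hk
    rw [sum_topSet] at hk
    obtain ⟨x, hx, hx1⟩ := exists_strictMono_sum_mul_eq_one _ k hk
    have hx2 : ∑ i, v i * x (σ.symm i) = 1 := by
      rw [← hx1, ← Equiv.sum_comp σ]
      simp
    obtain ⟨y, c, hyc⟩ := h.exists_affine rfl (z := fun i => x (σ.symm i) - ‖μ i‖ ^ 2) (by
      simp_rw [mul_sub, Finset.sum_sub_distrib, hx2, h.sum_sq, sub_self])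
    refine ⟨(-(1 / 2 : ℝ)) • y, fun i j hij => ?_⟩
    refine lt_of_pow_lt_pow_left₀ 2 (norm_nonneg _) ?_
    have hnorm : ∀ i, ‖(-(1 / 2 : ℝ)) • y - μ (σ i)‖ ^ 2 =
        ‖(-(1 / 2 : ℝ)) • y‖ ^ 2 - c + x i := fun i => by
      have := hyc (σ i)
      rw [Equiv.symm_apply_apply, real_inner_comm] at this
      rw [norm_sub_sq_real, inner_smul_left]
      simp only [conj_trivial]
      linarith
    rw [hnorm, hnorm]
    linarith [hx hij]

/-- A nonempty set with nonpositive sum is a top set of a ranking all of whose top sets have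
nonpositive sums. -/
theorem exists_topSet_eq_of_sum_nonpos {v : Fin m → ℝ} (hv : ∑ i, v i = 0)
    {I : Finset (Fin m)} (hI : I.Nonempty) (hsum : ∑ i ∈ I, v i ≤ 0) :
    ∃ σ k, topSet σ k = I ∧ σ ∉ rankingsMeeting (posSets v) := by
  let key : Fin m → ℕ := fun i => (if i ∈ I then 2 else 0) + (if v i < 0 then 1 else 0)
  let σ := Tuple.sort key
  have hσ : Monotone (key ∘ σ) := Tuple.monotone_sort key
  have hmemI : ∀ {i j}, i ∈ I → key i ≤ key j → j ∈ I := fun {i j} hi hij => by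
    by_contra hj
    simp only [key, if_pos hi, if_neg hj] at hij
    split_ifs at hij <;> omega
  have hne : (Finset.univ.filter fun l => σ l ∈ I).Nonempty := by
    obtain ⟨i, hi⟩ := hI
    exact ⟨σ.symm i, by simpa using hi⟩
  refine ⟨σ, (Finset.univ.filter fun l => σ l ∈ I).min' hne, ?_, ?_⟩
  · ext i
    rw [mem_topSet]
    constructor
    · intro hi
      have h1 := (Finset.mem_filter.1 (Finset.min'_mem _ hne)).2
      have h2 := hσ hi
      simp only [Function.comp_apply, Equiv.apply_symm_apply] at h2
      exact hmemI h1 h2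
    · intro hi
      exact Finset.min'_le _ _ (by simpa using hi)
  · rintro ⟨k, hk⟩
    have hk : 0 < ∑ i ∈ topSet σ k, v i := hk
    set T := topSet σ k
    have hT : ∀ {i j}, i ∈ T → j ∉ T → key j ≤ key i := fun {i j} hi hj => by
      rw [mem_topSet] at hi hj
      have := hσ ((lt_of_not_ge hj).le.trans hi)
      simpa using this
    by_cases hTI : T ⊆ I
    · by_cases hneg : ∀ i ∈ T, v i < 0
      · exact absurd hk (not_lt.2 (Finset.sum_nonpos fun i hi => (hneg i hi).le))
      · push Not at hneg
        obtain ⟨i, hi, hvi⟩ := hneg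
        have hle : ∑ j ∈ T, v j ≤ ∑ j ∈ I, v j := by
          refine Finset.sum_le_sum_of_subset_of_nonneg hTI fun j hj hjT => ?_
          by_contra! hvj
          have := hT hi hjT
          simp [key, hj, hTI hi, hvj, not_lt.2 hvi] at this
        linarith
    · obtain ⟨i, hi, hiI⟩ := Finset.not_subset.1 hTI
      have hIT : I ⊆ T := fun j hj => by
        by_contra hjT
        exact hiI (hmemI hj (hT hi hjT))
      by_cases hneg : ∀ j ∈ T, j ∉ I → v j < 0
      · have hle : ∑ j ∈ T, v j ≤ ∑ j ∈ I, v j := by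
          rw [← Finset.sum_sdiff hIT]
          have := Finset.sum_nonpos (s := T \ I) (f := v) fun j hj =>
            (hneg j (Finset.mem_sdiff.1 hj).1 (Finset.mem_sdiff.1 hj).2).le
          linarith
        linarith
      · push Not at hneg
        obtain ⟨i, hi, hiI, hvi⟩ := hneg
        have hnn : 0 ≤ ∑ j ∈ Tᶜ, v j := by
          refine Finset.sum_nonneg fun j hj => ?_
          by_contra! hvj
          have := hT hi (Finset.mem_compl.1 hj)
          simp [key, hiI, hvj, not_lt.2 hvi] at this
        have := Finset.sum_add_sum_compl T v
        linarith

theorem rankingsMeeting_injOn :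
    Set.InjOn rankingsMeeting (posSets '' {v : Fin m → ℝ | ∑ i, v i = 0}) := by
  have key : ∀ {v w : Fin m → ℝ}, ∑ i, v i = 0 →
      rankingsMeeting (posSets v) = rankingsMeeting (posSets w) → posSets w ⊆ posSets v := by
    intro v w hv heq I hI
    by_contra hIv
    have hne : I.Nonempty := by
      rw [Finset.nonempty_iff_ne_empty]
      rintro rfl
      simp [posSets] at hI
    obtain ⟨σ, k, hk, hσ⟩ := exists_topSet_eq_of_sum_nonpos hv hne (not_lt.1 hIv)
    rw [heq] at hσ
    exact hσ ⟨k, hk ▸ hI⟩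
  rintro _ ⟨v, hv, rfl⟩ _ ⟨w, hw, rfl⟩ heq
  exact (key hw heq.symm).antisymm (key hv heq)

/-- Zero-sum vectors with nonzero proper partial sums and at least two positive entries. -/
structure IsAdmissible (v : Fin m → ℝ) : Prop where
  sum_eq : ∑ i, v i = 0
  sum_ne : ∀ I : Finset (Fin m), I.Nonempty → I ≠ Finset.univ → ∑ i ∈ I, v i ≠ 0
  two_pos : ∃ a b, a ≠ b ∧ 0 < v a ∧ 0 < v b

theorem numRankingPatternsUF_eq (hm : 3 ≤ m) :
    numRankingPatternsUF m = (posSets '' {v : Fin m → ℝ | IsAdmissible v}).ncard := by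
  have hinj : Set.InjOn rankingsMeeting (posSets '' {v : Fin m → ℝ | IsAdmissible v}) :=
    rankingsMeeting_injOn.mono (Set.image_mono fun v hv => hv.sum_eq)
  rw [← hinj.ncard_image, numRankingPatternsUF]
  congr 1
  ext R
  constructor
  · rintro ⟨μ, hμ, rfl⟩
    obtain ⟨v, hv, hne⟩ := hμ.exists_isDependency (by omega)
    exact ⟨_, ⟨v, ⟨hv.sum_eq, hne, hv.exists_two_pos⟩, rfl⟩,
      (hv.rankingPatternUF_eq (by omega)).symm⟩
  · rintro ⟨_, ⟨v, hv, rfl⟩, rfl⟩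
    obtain ⟨a, b, hab, ha, hb⟩ := hv.two_pos
    obtain ⟨c, hc⟩ : ∃ c, c ∉ ({a, b} : Finset (Fin m)) := by
      by_contra! hall
      have h1 := Finset.card_le_card (fun c _ => hall c : Finset.univ ⊆ ({a, b} : Finset (Fin m)))
      have h2 : ({a, b} : Finset (Fin m)).card ≤ 2 := Finset.card_le_two
      simp only [Finset.card_univ, Fintype.card_fin] at h1
      omega
    simp only [Finset.mem_insert, Finset.mem_singleton, not_or] at hc
    obtain ⟨μ, hμ⟩ := exists_isDependency_of_two_pos (n := m - 2) (by omega) hv.sum_eq hab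
      (Ne.symm hc.1) (Ne.symm hc.2) ha hb
    exact ⟨μ, hμ.generic (by omega) hv.sum_ne, (hμ.rankingPatternUF_eq (by omega)).symm⟩

end RankingPattern

section Census

/-- The subset of `Fin m` whose indicator is the binary expansion of `k`. -/
def maskSet (m k : ℕ) : Finset (Fin m) := Finset.univ.filter fun i => k.testBit i

/-- The number whose `j`-th bit is `s j` for `1 ≤ j ≤ k` and all of whose other bits vanish. -/
def bitCode (s : ℕ → Bool) : ℕ → ℕ
  | 0 => 0
  | k + 1 => bitCode s k ||| if s (k + 1) then 2 ^ (k + 1) else 0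

/-- Whether the signs coded by `p` respect all splittings of the mask `k` into two parts: parts of
equal sign force the sign of `k`. -/
def isConsistentAt (k p : ℕ) : Bool :=
  (List.range k).all fun i => i == 0 || i &&& k != i || p.testBit i != p.testBit (k ^^^ i) ||
    p.testBit k == p.testBit i

/-- The consistent sign patterns on the masks `1, …, k`. -/
def signPatterns : ℕ → List ℕ
  | 0 => [0]
  | k + 1 => (signPatterns k).flatMap fun p =>
      [p, p ||| 2 ^ (k + 1)].filter (isConsistentAt (k + 1))

/-- The sign of the coordinate `i` of a zero-sum vector of length `n + 1` with sign pattern `p`. -/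
def coordPos (n p i : ℕ) : Bool :=
  if i < n then p.testBit (2 ^ i) else !p.testBit (2 ^ n - 1)

/-- Whether a sign pattern has at least two positive coordinates. -/
def hasTwoPos (n p : ℕ) : Bool :=
  decide (∃ a b : Fin (n + 1), a ≠ b ∧ coordPos n p a ∧ coordPos n p b)

/-- The sign patterns of admissible vectors of length `n + 1`. -/
def admissiblePatterns (n : ℕ) : List ℕ :=
  (signPatterns (2 ^ n - 1)).filter (hasTwoPos n)

/-- A weighted Chow parameter of the sign pattern `p`: these are nonnegative weights whose
deviations from the mean have sign pattern `p`. -/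
def chowWeight (n p i : ℕ) : ℕ :=
  ((List.range (2 ^ n)).countP fun k => p.testBit k == k.testBit i) +
    bif coordPos n p i then 2 else 0

/-- Whether the deviations of the weights `chowWeight n p` from their mean have sign
pattern `p`. -/
def isRealized (n p : ℕ) : Bool :=
  bitCode p.testBit (2 ^ n - 1) == p && (List.range (2 ^ n)).all fun k => k == 0 ||
    let c := (List.range (n + 1)).countP k.testBit
    let s := (((List.range (n + 1)).filter k.testBit).map (chowWeight n p)).sum
    let t := ((List.range (n + 1)).map (chowWeight n p)).sum
    bif p.testBit k then Nat.blt (c * t) ((n + 1) * s) else Nat.blt ((n + 1) * s) (c * t)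

theorem testBit_bitCode (s : ℕ → Bool) (k j : ℕ) :
    (bitCode s k).testBit j = (decide (1 ≤ j ∧ j ≤ k) && s j) := by
  induction k with
  | zero =>
    have : ¬ (1 ≤ j ∧ j ≤ 0) := by omega
    rw [bitCode, Nat.zero_testBit, decide_eq_false this, Bool.false_and]
  | succ k ih =>
    rw [bitCode, Nat.testBit_or, ih]
    by_cases hj : j = k + 1
    · subst hj
      by_cases hs : s (k + 1) <;> simp [hs, Nat.testBit_two_pow_self]
    · have h1 : (if s (k + 1) then 2 ^ (k + 1) else 0).testBit j = false := by
        split_ifs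
        · rw [Nat.testBit_two_pow]
          simpa using Ne.symm hj
        · simp
      have h2 : (1 ≤ j ∧ j ≤ k) ↔ (1 ≤ j ∧ j ≤ k + 1) := by omega
      simp [h1, h2]

theorem bitCode_congr {s s' : ℕ → Bool} {k : ℕ} (h : ∀ j, 1 ≤ j → j ≤ k → s j = s' j) :
    bitCode s k = bitCode s' k := by
  refine Nat.eq_of_testBit_eq fun j => ?_
  rw [testBit_bitCode, testBit_bitCode]
  by_cases hj : 1 ≤ j ∧ j ≤ k
  · rw [h j hj.1 hj.2]
  · simp [hj]

theorem xor_and_eq_xor {i k : ℕ} (h : i &&& k = i) : (k ^^^ i) &&& k = k ^^^ i := by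
  rw [Nat.and_xor_distrib_right, Nat.and_self, h]

theorem bitCode_mem_signPatterns (s : ℕ → Bool) (K : ℕ)
    (h : ∀ k i, k ≤ K → i ≠ 0 → i ≠ k → i &&& k = i → s i = s (k ^^^ i) → s k = s i) :
    bitCode s K ∈ signPatterns K := by
  induction K with
  | zero => simp [bitCode, signPatterns]
  | succ K ih =>
    rw [signPatterns, List.mem_flatMap]
    refine ⟨bitCode s K, ih fun k i hk => h k i (by omega), List.mem_filter.2 ⟨?_, ?_⟩⟩
    · by_cases hs : s (K + 1) <;> simp [bitCode, hs]
    · rw [isConsistentAt, List.all_eq_true]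
      intro i hi
      rw [List.mem_range] at hi
      by_cases hi0 : i = 0
      · simp [hi0]
      by_cases hik : i &&& (K + 1) = i
      · have hxle : (K + 1) ^^^ i ≤ K + 1 := by
          rw [← xor_and_eq_xor hik]
          exact Nat.and_le_right
        have hx0 : (K + 1) ^^^ i ≠ 0 := fun h0 => by
          rw [Nat.xor_eq_zero_iff] at h0
          omega
        have h1 := h (K + 1) i le_rfl hi0 (by omega) hik
        have hb : ∀ j, j ≠ 0 → j ≤ K + 1 → (bitCode s (K + 1)).testBit j = s j :=
          fun j hj0 hj => by
            rw [testBit_bitCode]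
            have : 1 ≤ j ∧ j ≤ K + 1 := by omega
            simp [this]
        rw [hb i hi0 hi.le, hb _ hx0 hxle, hb _ (by omega) le_rfl]
        by_cases h2 : s i = s ((K + 1) ^^^ i)
        · simp [h1 h2]
        · simp [h2]
      · simp [hik]

theorem lt_of_mem_signPatterns {K p : ℕ} (hp : p ∈ signPatterns K) : p < 2 ^ (K + 1) := by
  induction K generalizing p with
  | zero => simp_all [signPatterns]
  | succ K ih =>
    rw [signPatterns, List.mem_flatMap] at hp
    obtain ⟨q, hq, hp⟩ := hp
    have h1 : q < 2 ^ (K + 1 + 1) := (ih hq).trans (Nat.pow_lt_pow_right (by omega) (by omega))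
    have h2 := (List.mem_filter.1 hp).1
    simp only [List.mem_cons, List.not_mem_nil, or_false] at h2
    rcases h2 with rfl | rfl
    · exact h1
    · exact Nat.or_lt_two_pow h1 (Nat.pow_lt_pow_right (by omega) (by omega))

theorem nodup_signPatterns (K : ℕ) : (signPatterns K).Nodup := by
  induction K with
  | zero => simp [signPatterns]
  | succ K ih =>
    have hmod : ∀ q ∈ signPatterns K, ∀ p ∈ [q, q ||| 2 ^ (K + 1)], p % 2 ^ (K + 1) = q := by
      intro q hq p hp
      have hlt := lt_of_mem_signPatterns hq
      simp only [List.mem_cons, List.not_mem_nil, or_false] at hp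
      rcases hp with rfl | rfl
      · exact Nat.mod_eq_of_lt hlt
      · rw [Nat.or_mod_two_pow, Nat.mod_self, Nat.or_zero, Nat.mod_eq_of_lt hlt]
    rw [signPatterns, List.nodup_flatMap]
    refine ⟨fun q hq => List.Nodup.filter _ ?_, ih.imp_of_mem fun {q q'} hq hq' hne => ?_⟩
    · have hlt := lt_of_mem_signPatterns hq
      have hne : q ≠ q ||| 2 ^ (K + 1) := fun h => by
        have : 2 ^ (K + 1) ≤ q := by
          rw [h]
          exact Nat.right_le_or
        omega
      simpa using hne
    · intro p hp hp'
      exact hne ((hmod q hq p (List.mem_filter.1 hp).1).symm.trans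
        (hmod q' hq' p (List.mem_filter.1 hp').1))

variable {n : ℕ}

theorem mem_maskSet {m k : ℕ} {i : Fin m} : i ∈ maskSet m k ↔ k.testBit i = true := by
  simp [maskSet]

theorem sum_maskSet_split {m i k : ℕ} (h : i &&& k = i) (v : Fin m → ℝ) :
    ∑ j ∈ maskSet m k, v j = ∑ j ∈ maskSet m i, v j + ∑ j ∈ maskSet m (k ^^^ i), v j := by
  have hbit : ∀ j, i.testBit j = true → k.testBit j = true := fun j hj => by
    rw [← h, Nat.testBit_and] at hj
    exact (Bool.and_eq_true_iff.1 hj).2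
  rw [← Finset.sum_union]
  · refine Finset.sum_congr (Finset.ext fun j => ?_) fun _ _ => rfl
    rw [Finset.mem_union, mem_maskSet, mem_maskSet, mem_maskSet, Nat.testBit_xor]
    have := hbit j
    cases hi : i.testBit j <;> cases hk : k.testBit j <;> simp_all
  · rw [Finset.disjoint_left]
    intro j hj
    rw [mem_maskSet] at hj ⊢
    rw [Nat.testBit_xor, hj, hbit j hj]
    simp

theorem last_notMem_maskSet {k : ℕ} (hk : k < 2 ^ n) : Fin.last n ∉ maskSet (n + 1) k := by
  rw [mem_maskSet, Fin.val_last, Nat.testBit_lt_two_pow hk]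
  simp

theorem maskSet_ne_univ {k : ℕ} (hk : k < 2 ^ n) : maskSet (n + 1) k ≠ Finset.univ := fun h =>
  last_notMem_maskSet hk (h ▸ Finset.mem_univ _)

theorem maskSet_nonempty {k : ℕ} (hk : k < 2 ^ n) (hk0 : k ≠ 0) :
    (maskSet (n + 1) k).Nonempty := by
  obtain ⟨i, hi⟩ := Nat.exists_testBit_of_ne_zero hk0
  have hin : i < n := by
    by_contra! hni
    rw [Nat.testBit_lt_two_pow (hk.trans_le (Nat.pow_le_pow_right two_pos hni))] at hi
    simp at hi
  exact ⟨⟨i, by omega⟩, mem_maskSet.2 hi⟩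

theorem exists_maskSet_eq {I : Finset (Fin (n + 1))} (hI : Fin.last n ∉ I) :
    ∃ k < 2 ^ n, maskSet (n + 1) k = I := by
  refine ⟨Nat.ofBits fun i : Fin (n + 1) => decide (i ∈ I), ?_, ?_⟩
  · refine Nat.lt_pow_two_of_testBit _ fun i hi => ?_
    rcases hi.eq_or_lt with rfl | hi
    · rw [Nat.testBit_ofBits_lt _ _ (Nat.lt_succ_self _)]
      exact decide_eq_false hI
    · exact Nat.testBit_ofBits_ge _ _ hi
  · ext i
    rw [mem_maskSet, Nat.testBit_ofBits_lt _ _ i.2]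
    simp

theorem maskSet_two_pow (i : Fin n) : maskSet (n + 1) (2 ^ (i : ℕ)) = {i.castSucc} := by
  ext j
  rw [mem_maskSet, Nat.testBit_two_pow, Finset.mem_singleton, decide_eq_true_eq, Fin.ext_iff,
    Fin.val_castSucc, eq_comm]

theorem maskSet_two_pow_sub_one : maskSet (n + 1) (2 ^ n - 1) = {Fin.last n}ᶜ := by
  ext j
  rw [mem_maskSet, Nat.testBit_two_pow_sub_one, Finset.mem_compl, Finset.mem_singleton,
    decide_eq_true_eq, Fin.ext_iff, Fin.val_last]
  omega

open scoped Classical in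
/-- The sign pattern of a family of positive sets. -/
noncomputable def signCode (n : ℕ) (P : Set (Finset (Fin (n + 1)))) : ℕ :=
  bitCode (fun k => decide (maskSet (n + 1) k ∈ P)) (2 ^ n - 1)

theorem testBit_signCode {P : Set (Finset (Fin (n + 1)))} {k : ℕ} (hk : k < 2 ^ n)
    (hk0 : k ≠ 0) : (signCode n P).testBit k = true ↔ maskSet (n + 1) k ∈ P := by
  have : 1 ≤ k ∧ k ≤ 2 ^ n - 1 := by omega
  rw [signCode, testBit_bitCode]
  simp [this]

theorem mem_posSets {m : ℕ} {v : Fin m → ℝ} {I : Finset (Fin m)} :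
    I ∈ posSets v ↔ 0 < ∑ i ∈ I, v i := Iff.rfl

theorem IsAdmissible.compl_mem_posSets {m : ℕ} {v : Fin m → ℝ} (hv : IsAdmissible v)
    {I : Finset (Fin m)} (hI : I.Nonempty) (hI' : I ≠ Finset.univ) :
    Iᶜ ∈ posSets v ↔ I ∉ posSets v := by
  have h1 := hv.sum_ne I hI hI'
  have h2 := Finset.sum_add_sum_compl I v
  rw [hv.sum_eq] at h2
  rw [mem_posSets, mem_posSets, not_lt]
  exact ⟨fun h => by linarith, fun h => by linarith [lt_of_le_of_ne h h1]⟩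

theorem signCode_injOn :
    Set.InjOn (signCode n) (posSets '' {v : Fin (n + 1) → ℝ | IsAdmissible v}) := by
  rintro _ ⟨v, hv, rfl⟩ _ ⟨w, hw, rfl⟩ heq
  have hv : IsAdmissible v := hv
  have hw : IsAdmissible w := hw
  have key : ∀ I : Finset (Fin (n + 1)), I.Nonempty → Fin.last n ∉ I →
      (I ∈ posSets v ↔ I ∈ posSets w) := fun I hI hlast => by
    obtain ⟨k, hk, rfl⟩ := exists_maskSet_eq hlast
    have hk0 : k ≠ 0 := by
      rintro rfl
      simp [maskSet] at hI
    rw [← testBit_signCode hk hk0, ← testBit_signCode hk hk0, heq]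
  ext I
  by_cases hlast : Fin.last n ∈ I
  · by_cases hI : I = Finset.univ
    · rw [hI, mem_posSets, mem_posSets, hv.sum_eq, hw.sum_eq]
    · have hne : Iᶜ.Nonempty := by
        rwa [Finset.nonempty_iff_ne_empty, Ne, Finset.compl_eq_empty_iff]
      have h1 := key Iᶜ hne (by simpa using hlast)
      rw [hv.compl_mem_posSets ⟨_, hlast⟩ hI, hw.compl_mem_posSets ⟨_, hlast⟩ hI] at h1
      exact not_iff_not.1 h1
  · rcases I.eq_empty_or_nonempty with rfl | hI
    · simp [mem_posSets]
    · exact key I hI hlast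

theorem coordPos_signCode (hn : n ≠ 0) {v : Fin (n + 1) → ℝ} (hv : ∑ i, v i = 0)
    (hne : ∀ i, v i ≠ 0) (i : Fin (n + 1)) :
    coordPos n (signCode n (posSets v)) i = true ↔ 0 < v i := by
  rcases Fin.eq_castSucc_or_eq_last i with ⟨i, rfl⟩ | rfl
  · rw [coordPos, Fin.val_castSucc, if_pos i.2,
      testBit_signCode (Nat.pow_lt_pow_right one_lt_two i.2) (by positivity), maskSet_two_pow,
      mem_posSets, Finset.sum_singleton]
  · have h1 : 1 < 2 ^ n := Nat.one_lt_two_pow hn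
    rw [coordPos, Fin.val_last, if_neg (lt_irrefl n), Bool.not_eq_true', ← Bool.not_eq_true,
      testBit_signCode (by omega) (by omega), maskSet_two_pow_sub_one, mem_posSets, not_lt]
    have h2 := Finset.sum_add_sum_compl {Fin.last n} v
    rw [hv, Finset.sum_singleton] at h2
    have h3 := hne (Fin.last n)
    exact ⟨fun h => lt_of_le_of_ne (by linarith) h3.symm, fun h => by linarith⟩

theorem IsAdmissible.signCode_mem (hn : n ≠ 0) {v : Fin (n + 1) → ℝ} (hv : IsAdmissible v) :
    signCode n (posSets v) ∈ admissiblePatterns n := by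
  refine List.mem_filter.2 ⟨?_, ?_⟩
  · refine bitCode_mem_signPatterns _ _ fun k i hk hi0 hik hand heq => ?_
    have h2n : 0 < 2 ^ n := by positivity
    have hile : i ≤ k := by
      rw [← hand]
      exact Nat.and_le_right
    have hx0 : k ^^^ i ≠ 0 := fun h => hik (Nat.xor_eq_zero_iff.1 h).symm
    have hxle : k ^^^ i ≤ k := by
      rw [← xor_and_eq_xor hand]
      exact Nat.and_le_right
    have hne : ∀ j, j ≠ 0 → j ≤ k → ∑ l ∈ maskSet (n + 1) j, v l ≠ 0 := fun j hj0 hj =>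
      hv.sum_ne _ (maskSet_nonempty (by omega) hj0) (maskSet_ne_univ (by omega))
    have h1 := hne i hi0 hile
    have h2 := hne _ hx0 hxle
    rw [decide_eq_decide] at heq ⊢
    rw [mem_posSets, mem_posSets] at heq ⊢
    rw [sum_maskSet_split hand]
    rcases lt_or_gt_of_ne h1 with h1 | h1
    · have h3 := not_lt.1 (mt heq.2 h1.not_gt)
      exact ⟨fun h => by linarith, fun h => by linarith⟩
    · have h3 := heq.1 h1
      exact ⟨fun _ => h1, fun h => by linarith⟩
  · obtain ⟨a, b, hab, ha, hb⟩ := hv.two_pos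
    have hcoord := coordPos_signCode hn hv.sum_eq fun i => by
      have := hv.sum_ne {i} (Finset.singleton_nonempty i) fun h => by
        have h1 := congrArg Finset.card h
        simp at h1
        omega
      simpa using this
    exact decide_eq_true ⟨a, b, hab, (hcoord a).2 ha, (hcoord b).2 hb⟩

theorem list_sum_map_range {m : ℕ} (f : ℕ → ℕ) :
    ((List.range m).map f).sum = ∑ i : Fin m, f i := by
  rw [Fin.sum_univ_eq_sum_range, Finset.sum_range, Fin.sum_univ_def,
    ← List.map_coe_finRange_eq_range,
    List.map_map]
  rfl

theorem list_sum_map_filter_testBit {m k : ℕ} (f : ℕ → ℕ) :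
    (((List.range m).filter k.testBit).map f).sum = ∑ i ∈ maskSet m k, f i := by
  rw [maskSet, Finset.sum_filter, ← list_sum_map_range fun i => if k.testBit i then f i else 0]
  induction List.range m with
  | nil => rfl
  | cons a l ih => by_cases h : k.testBit a <;> simp [h, ih]

theorem list_countP_testBit {m k : ℕ} :
    (List.range m).countP k.testBit = (maskSet m k).card := by
  rw [List.countP_eq_length_filter, Finset.card_eq_sum_ones,
    ← list_sum_map_filter_testBit fun _ => 1]
  simp

theorem exists_isAdmissible_of_isRealized (hn : n ≠ 0) {p : ℕ} (hp : hasTwoPos n p = true)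
    (h : isRealized n p = true) :
    ∃ v : Fin (n + 1) → ℝ, IsAdmissible v ∧ signCode n (posSets v) = p := by
  rw [isRealized, Bool.and_eq_true, beq_iff_eq, List.all_eq_true] at h
  obtain ⟨hcode, hmask⟩ := h
  set t := ∑ i : Fin (n + 1), chowWeight n p i with ht
  let v : Fin (n + 1) → ℝ := fun i => (n + 1) * chowWeight n p i - t
  have hsum : ∑ i, v i = 0 := by
    simp only [v, Finset.sum_sub_distrib, ← Finset.mul_sum, ht]
    push_cast
    simp
  have hmaskSum : ∀ k, ∑ i ∈ maskSet (n + 1) k, v i =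
      (((n + 1) * ∑ i ∈ maskSet (n + 1) k, chowWeight n p i : ℕ) : ℝ) -
        ((maskSet (n + 1) k).card * t : ℕ) := fun k => by
    simp only [v, Finset.sum_sub_distrib, ← Finset.mul_sum]
    push_cast
    simp
  have hsign : ∀ k < 2 ^ n, k ≠ 0 → (p.testBit k = true ↔ 0 < ∑ i ∈ maskSet (n + 1) k, v i) ∧
      ∑ i ∈ maskSet (n + 1) k, v i ≠ 0 := fun k hk hk0 => by
    have h1 := hmask k (List.mem_range.2 hk)
    simp only [list_sum_map_range, list_sum_map_filter_testBit, list_countP_testBit, ← ht] at h1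
    rw [hmaskSum, sub_pos, sub_ne_zero, Nat.cast_lt, Ne, Nat.cast_inj]
    cases hb : p.testBit k
    · simp only [hb, cond_false, Bool.or_eq_true, beq_iff_eq, hk0, false_or, Nat.blt_eq] at h1
      exact ⟨⟨fun h => by simp at h, fun h => by omega⟩, by omega⟩
    · simp only [hb, cond_true, Bool.or_eq_true, beq_iff_eq, hk0, false_or, Nat.blt_eq] at h1
      exact ⟨⟨fun _ => h1, fun _ => rfl⟩, by omega⟩
  have hsumne : ∀ I : Finset (Fin (n + 1)), I.Nonempty → I ≠ Finset.univ →
      ∑ i ∈ I, v i ≠ 0 := by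
    have key : ∀ I : Finset (Fin (n + 1)), I.Nonempty → Fin.last n ∉ I → ∑ i ∈ I, v i ≠ 0 :=
      fun I hI hlast => by
        obtain ⟨k, hk, rfl⟩ := exists_maskSet_eq hlast
        refine (hsign k hk ?_).2
        rintro rfl
        simp [maskSet] at hI
    intro I hI hI'
    by_cases hlast : Fin.last n ∈ I
    · have hne : Iᶜ.Nonempty := by
        rwa [Finset.nonempty_iff_ne_empty, Ne, Finset.compl_eq_empty_iff]
      have h1 := key Iᶜ hne (by simpa using hlast)
      have h2 := Finset.sum_add_sum_compl I v
      intro h0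
      exact h1 (by linarith)
    · exact key I hI hlast
  have hsc : signCode n (posSets v) = p := by
    have h2n : 0 < 2 ^ n := by positivity
    rw [← hcode, signCode]
    refine bitCode_congr fun j hj1 hj2 => ?_
    rw [Bool.eq_iff_iff, (hsign j (by omega) (by omega)).1]
    simp [mem_posSets]
  refine ⟨v, ⟨hsum, hsumne, ?_⟩, hsc⟩
  have hcoord := coordPos_signCode hn hsum fun i => by
    have := hsumne {i} (Finset.singleton_nonempty i) fun h => by
      have h1 := congrArg Finset.card h
      simp at h1
      omega
    simpa using this
  obtain ⟨a, b, hab, ha, hb⟩ := of_decide_eq_true hp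
  rw [← hsc] at ha hb
  exact ⟨a, b, hab, (hcoord a).1 ha, (hcoord b).1 hb⟩

theorem numRankingPatternsUF_succ (hn : 2 ≤ n)
    (h : (admissiblePatterns n).all (isRealized n) = true) :
    numRankingPatternsUF (n + 1) = (admissiblePatterns n).length := by
  have himage : signCode n '' (posSets '' {v : Fin (n + 1) → ℝ | IsAdmissible v}) =
      ((admissiblePatterns n).toFinset : Set ℕ) := by
    ext p
    rw [List.coe_toFinset, Set.mem_ofPred_eq]
    constructor
    · rintro ⟨_, ⟨v, hv, rfl⟩, rfl⟩
      exact IsAdmissible.signCode_mem (by omega) hv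
    · intro hp
      obtain ⟨v, hv, rfl⟩ := exists_isAdmissible_of_isRealized (by omega)
        (List.mem_filter.1 hp).2 (List.all_eq_true.1 h p hp)
      exact ⟨_, ⟨v, hv, rfl⟩, rfl⟩
  rw [numRankingPatternsUF_eq (by omega), ← signCode_injOn.ncard_image, himage,
    Set.ncard_coe_finset]
  exact List.toFinset_card_of_nodup ((nodup_signPatterns _).filter _)

end Census

/-- Corollary 5.4 (the cases `m = 3, 4, 5`): `q(3) = 3`, `q(4) = 28`,
`q(5) = 365`. -/
theorem numRankingPatternsUF_values :
    numRankingPatternsUF 3 = 3 ∧ numRankingPatternsUF 4 = 28 ∧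
      numRankingPatternsUF 5 = 365 := by
  have h2 : (admissiblePatterns 2).length = 3 ∧
      (admissiblePatterns 2).all (isRealized 2) = true := by decide +kernel
  have h3 : (admissiblePatterns 3).length = 28 ∧
      (admissiblePatterns 3).all (isRealized 3) = true := by decide +kernel
  have h4 : (admissiblePatterns 4).length = 365 ∧
      (admissiblePatterns 4).all (isRealized 4) = true := by decide +kernel
  exact ⟨(numRankingPatternsUF_succ (by norm_num) h2.2).trans h2.1,
    (numRankingPatternsUF_succ (by norm_num) h3.2).trans h3.1,
    (numRankingPatternsUF_succ (by norm_num) h4.2).trans h4.1⟩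
end

section
/- Let m ≥ 3. Let the symmetric group S_m act on sets R of permutations of [m] by σ·R = {(σ(i_1)⋯σ(i_m)) : (i_1⋯i_m) ∈ R}, and call two ranking patterns equivalent if one is obtained from the other by this action. Let N be the number of connected components of the topological subspace {x ∈ H0 : ∑_{i∈I} x_i ≠ 0 for every nonempty proper subset I ⊂ [m], and x_i ≠ x_j for all 1 ≤ i < j ≤ m} of ℝ^m. Then the number of equivalence classes of the set {RP^UF(μ_1,…,μ_m) : μ_1,…,μ_m ∈ ℝ^{m−2} generic} is at most N/m! − 1. -/
open scoped BigOperators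

/-- The chamber `C_{i₁⋯i_m}` of the braid arrangement restricted to
`H0 = {x : ∑ᵢ xᵢ = 0}`, associated with the permutation `σ` (where `σ k` is the
object ranked in position `k`). -/
def braidChamber {m : ℕ} (σ : Equiv.Perm (Fin m)) :
    Set (EuclideanSpace ℝ (Fin m)) :=
  {x | (∑ i, x i = 0) ∧ ∀ k l : Fin m, k < l → x (σ l) < x (σ k)}

/-- The slicing hyperplane `K_v = {x ∈ H0 : vᵀ x = 1}`. -/
def sliceK {m : ℕ} (v : EuclideanSpace ℝ (Fin m)) :
    Set (EuclideanSpace ℝ (Fin m)) :=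
  {x | (∑ i, x i = 0) ∧ ∑ i, v i * x i = 1}

/-- The set `V` of generic unit directions: `v ∈ H0`, `‖v‖ = 1`, and all sums of
entries of `v` over nonempty proper subsets of `[m]` are nonzero. -/
def genericDirections (m : ℕ) : Set (EuclideanSpace ℝ (Fin m)) :=
  {v | (∑ i, v i = 0) ∧ ‖v‖ = 1 ∧
    ∀ I : Finset (Fin m), I.Nonempty → I ≠ Finset.univ → ∑ i ∈ I, v i ≠ 0}

/-- The ranking pattern of the braid slice by `K_v`. -/
def rankingPattern {m : ℕ} (v : EuclideanSpace ℝ (Fin m)) :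
    Set (Equiv.Perm (Fin m)) :=
  {σ | (sliceK v ∩ braidChamber σ).Nonempty}

/-- Two ranking patterns are equivalent iff one is obtained from the other by
relabelling the objects: `σ·R = {(σ(i₁)⋯σ(i_m)) : (i₁⋯i_m) ∈ R}`. -/
def patternEquiv {m : ℕ} (R R' : Set (Equiv.Perm (Fin m))) : Prop :=
  ∃ σ : Equiv.Perm (Fin m), R = (fun τ => σ * τ) '' R'

/-- The set of ranking patterns of unfolding models of codimension one. -/
def rankingPatternsUF (m : ℕ) : Set (Set (Equiv.Perm (Fin m))) :=
  {R | ∃ μ : Fin m → EuclideanSpace ℝ (Fin (m - 2)),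
    Generic μ ∧ R = rankingPatternUF μ}

theorem SimpleGraph.isAcyclic_fromEdgeSet_of_leaves {V ι : Type*} {t p : ι → V}
    (ht : Function.Injective t) (hp : ∀ k l, p k ≠ t l) :
    (SimpleGraph.fromEdgeSet (Set.range fun k => s(t k, p k))).IsAcyclic := by
  rw [SimpleGraph.isAcyclic_iff_forall_isBridge]
  intro e he
  rw [SimpleGraph.edgeSet_fromEdgeSet] at he
  obtain ⟨⟨k, rfl⟩, -⟩ := he
  dsimp only
  rw [SimpleGraph.isBridge_iff]
  rintro ⟨w⟩
  obtain ⟨x, hx, -, -⟩ := w.exists_eq_cons_of_ne (hp k k).symm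
  rw [SimpleGraph.deleteEdges_adj, SimpleGraph.fromEdgeSet_adj] at hx
  obtain ⟨⟨⟨l, hl⟩, -⟩, hne⟩ := hx
  dsimp only at hl
  rw [Sym2.eq_iff] at hl
  rcases hl with ⟨h1, h2⟩ | ⟨-, h2⟩
  · obtain rfl := ht h1
    exact hne (by simp [h2])
  · exact hp _ _ h2

theorem ConditionA.linearIndependent {m N : ℕ} {E : Type*} [AddCommGroup E] [Module ℝ E]
    {ν : Fin m → E} (h : ConditionA N ν) {t p : Fin N → Fin m}
    (ht : Function.Injective t) (hp : ∀ k l, p k ≠ t l) :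
    LinearIndependent ℝ fun k => ν (t k) - ν (p k) := by
  refine (h (fun k => (t k, p k)) (fun k => (hp k k).symm) ?_).1
    (SimpleGraph.isAcyclic_fromEdgeSet_of_leaves ht hp)
  intro k l hkl
  dsimp only at hkl
  rw [Sym2.eq_iff] at hkl
  rcases hkl with ⟨h1, -⟩ | ⟨h1, -⟩
  · exact ht h1
  · exact absurd h1.symm (hp l k)

theorem Finset.exists_fin_embedding {α : Type*} [DecidableEq α] (s : Finset α) {N : ℕ}
    (hs : s.card = N) :
    ∃ t : Fin N → α, Function.Injective t ∧ (∀ k, t k ∈ s) ∧ (∀ i ∈ s, ∃ k, t k = i) ∧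
      ∀ {M : Type} [AddCommMonoid M] (f : α → M), ∑ k, f (t k) = ∑ i ∈ s, f i := by
  have e : Fin N ≃ s := (Fintype.equivFinOfCardEq (by simpa using hs)).symm
  refine ⟨fun k => e k, Subtype.val_injective.comp e.injective, fun k => (e k).2,
    fun i hi => ⟨e.symm ⟨i, hi⟩, by simp⟩, ?_⟩
  intro M _ f
  rw [e.sum_comp (fun i : s => f i), Finset.sum_coe_sort s f]

/-- An affine dependence of points satisfying `ConditionA (m - 2)` is zero as soon as one of its
proper partial sums is zero. -/
theorem ConditionA.dependence_eq_zero {m : ℕ} {E : Type} [AddCommGroup E] [Module ℝ E]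
    {ν : Fin m → E} (h : ConditionA (m - 2) ν) {v : Fin m → ℝ} (hv : ∑ i, v i = 0)
    (hvν : ∑ i, v i • ν i = 0) {I : Finset (Fin m)} (hI : I.Nonempty) (hI' : I ≠ Finset.univ)
    (hsum : ∑ i ∈ I, v i = 0) : v = 0 := by
  classical
  obtain ⟨a, ha⟩ := hI
  obtain ⟨b, hb⟩ : ∃ b, b ∉ I := by
    by_contra! hcon
    exact hI' (Finset.eq_univ_iff_forall.2 hcon)
  have hab : a ≠ b := fun h => hb (h ▸ ha)
  set s : Finset (Fin m) := Finset.univ \ {a, b} with hs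
  obtain ⟨t, ht, hts, hst, htsum⟩ := s.exists_fin_embedding (N := m - 2) (by
    rw [hs, Finset.card_sdiff_of_subset (Finset.subset_univ _), Finset.card_pair hab]; simp)
  let r : Fin m → Fin m := fun i => if i ∈ I then a else b
  have hli := h.linearIndependent (p := fun k => r (t k)) ht (by
    intro k l hkl
    have := hts l
    rw [← hkl] at this
    by_cases hk : t k ∈ I <;> simp [r, hk, hs] at this)
  have hsplit (f : Fin m → ℝ) (x y : E) :
      ∑ i, f i • (if i ∈ I then x else y) = (∑ i ∈ I, f i) • x + (∑ i ∈ Iᶜ, f i) • y := by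
    rw [← Finset.sum_add_sum_compl I, Finset.sum_smul, Finset.sum_smul]
    congr 1
    · exact Finset.sum_congr rfl fun i hi => by rw [if_pos hi]
    · exact Finset.sum_congr rfl fun i hi => by rw [if_neg (Finset.mem_compl.1 hi)]
  have hcompl : ∑ i ∈ Iᶜ, v i = 0 := by
    have := Finset.sum_add_sum_compl I v
    linarith
  have htotal : ∑ i, v i • (ν i - ν (r i)) = 0 := by
    simp only [smul_sub, Finset.sum_sub_distrib, hvν, r, apply_ite ν]
    rw [hsplit, hsum, hcompl]; simp
  have hsub : ∑ i ∈ s, v i • (ν i - ν (r i)) = 0 := by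
    rw [← htotal]
    refine Finset.sum_subset (Finset.subset_univ _) fun i _ hi => ?_
    have : i = a ∨ i = b := by
      by_contra hcon
      exact hi (by simp [hs]; tauto)
    rcases this with rfl | rfl
    · simp [r, ha]
    · simp [r, hb]
  rw [← htsum] at hsub
  have hzero := Fintype.linearIndependent_iff.1 hli (fun k => v (t k)) hsub
  have hs0 : ∀ i, i ≠ a → i ≠ b → v i = 0 := by
    intro i hia hib
    obtain ⟨k, rfl⟩ := hst i (by simp [hs, hia, hib])
    exact hzero k
  have hva : v a = 0 := by
    rw [← hsum]
    refine (Finset.sum_eq_single_of_mem a ha fun i hi hia => hs0 i hia ?_).symm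
    rintro rfl
    exact hb hi
  have hvb : v b = 0 := by
    rw [← hcompl]
    refine (Finset.sum_eq_single_of_mem b (Finset.mem_compl.2 hb) fun i hi hib =>
      hs0 i ?_ hib).symm
    rintro rfl
    exact Finset.mem_compl.1 hi ha
  ext i
  by_cases hia : i = a
  · rw [hia, hva]; rfl
  by_cases hib : i = b
  · rw [hib, hvb]; rfl
  exact hs0 i hia hib

/-- Points satisfying `ConditionA (m - 1)` are affinely independent. -/
theorem ConditionA.eq_zero {m : ℕ} [NeZero m] {E : Type} [AddCommGroup E] [Module ℝ E]
    {ν : Fin m → E} (h : ConditionA (m - 1) ν) {v : Fin m → ℝ} (hv : ∑ i, v i = 0)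
    (hvν : ∑ i, v i • ν i = 0) : v = 0 := by
  classical
  set s : Finset (Fin m) := Finset.univ.erase 0 with hs
  have hcard : s.card = m - 1 := by simp [hs]
  obtain ⟨t, ht, hts, hst, htsum⟩ := s.exists_fin_embedding hcard
  have hli := h.linearIndependent (p := fun _ => 0) ht (fun _ l h0 => by
    have := hts l
    rw [← h0] at this
    simp [hs] at this)
  have hsub : ∑ i ∈ s, v i • (ν i - ν 0) = 0 := by
    rw [hs, Finset.sum_erase _ (by simp)]
    simp [smul_sub, hvν, ← Finset.sum_smul, hv]
  rw [← htsum] at hsub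
  have hzero := Fintype.linearIndependent_iff.1 hli (fun k => v (t k)) hsub
  have hs0 : ∀ i, i ≠ 0 → v i = 0 := by
    intro i hi
    obtain ⟨k, rfl⟩ := hst i (by simp [hs, hi])
    exact hzero k
  ext i
  by_cases hi : i = 0
  · rw [Finset.sum_eq_single_of_mem 0 (Finset.mem_univ _) fun i _ hi => hs0 i hi] at hv
    rw [hi, hv]; rfl
  · exact hs0 i hi

theorem LinearIndependent.exists_inner_eq {E : Type*} [NormedAddCommGroup E]
    [InnerProductSpace ℝ E] [FiniteDimensional ℝ E] {ι : Type*} {b : ι → E}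
    (hb : LinearIndependent ℝ b) (c : ι → ℝ) : ∃ y : E, ∀ k, inner ℝ y (b k) = c k := by
  obtain ⟨f, hf⟩ := LinearMap.exists_extend ((Module.Basis.span hb).constr ℝ c)
  refine ⟨(InnerProductSpace.toDual ℝ E).symm f.toContinuousLinearMap, fun k => ?_⟩
  rw [InnerProductSpace.toDual_symm_apply]
  have h := LinearMap.congr_fun hf (Module.Basis.span hb k)
  rw [Module.Basis.constr_basis] at h
  simpa [Module.Basis.span_apply] using h

/-- Generic points of codimension one have an affine dependence, with nonzero proper partial sums,
whose orientation is fixed by the squared norms of the points. -/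
theorem Generic.exists_dependence {m : ℕ} (hm : 3 ≤ m)
    {μ : Fin m → EuclideanSpace ℝ (Fin (m - 2))} (h : Generic μ) :
    ∃ v : Fin m → ℝ, ∑ i, v i = 0 ∧ ∑ i, v i • μ i = 0 ∧ ∑ i, v i * ‖μ i‖ ^ 2 < 0 ∧
      ∀ I : Finset (Fin m), I.Nonempty → I ≠ Finset.univ → ∑ i ∈ I, v i ≠ 0 := by
  have : NeZero m := ⟨by omega⟩
  let f : (Fin m → ℝ) →ₗ[ℝ] ℝ × EuclideanSpace ℝ (Fin (m - 2)) :=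
    (Fintype.linearCombination ℝ fun _ => (1 : ℝ)).prod (Fintype.linearCombination ℝ μ)
  obtain ⟨v, hvker, hv0⟩ := (Submodule.ne_bot_iff _).1
    (LinearMap.ker_ne_bot_of_finrank_lt (f := f) (by simp; omega))
  have hker : ∑ i, v i = 0 ∧ ∑ i, v i • μ i = 0 := by
    simpa [f, Fintype.linearCombination_apply] using hvker
  obtain ⟨hv, hvμ⟩ := hker
  have hne : ∑ i, v i * ‖μ i‖ ^ 2 ≠ 0 := fun h0 =>
    hv0 (h.2.eq_zero hv (Prod.ext (by simpa [Prod.fst_sum] using hvμ)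
      (by simpa [Prod.snd_sum] using h0)))
  have hI : ∀ I : Finset (Fin m), I.Nonempty → I ≠ Finset.univ → ∑ i ∈ I, v i ≠ 0 :=
    fun I h1 h2 h3 => hv0 (h.1.dependence_eq_zero hv hvμ h1 h2 h3)
  rcases hne.lt_or_gt with hlt | hgt
  · exact ⟨v, hv, hvμ, hlt, hI⟩
  · exact ⟨-v, by simpa using hv, by simpa using hvμ, by simpa using hgt,
      fun I h1 h2 => by simpa using hI I h1 h2⟩

/-- A dependence with negative squared-norm sum cannot have exactly one nonpositive entry. -/
theorem exists_ne_nonpos_of_dependence {ι E : Type*} [Fintype ι] [NormedAddCommGroup E]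
    [InnerProductSpace ℝ E] {μ : ι → E} {v : ι → ℝ} (hv : ∑ i, v i = 0)
    (hvμ : ∑ i, v i • μ i = 0) (hneg : ∑ i, v i * ‖μ i‖ ^ 2 < 0) (j : ι) :
    ∃ i, i ≠ j ∧ v i ≤ 0 := by
  by_contra! hcon
  have hexp : ∑ i, v i * ‖μ i - μ j‖ ^ 2 = ∑ i, v i * ‖μ i‖ ^ 2 := by
    have h1 : ∑ i, v i * inner ℝ (μ i) (μ j) = 0 := by
      simpa [sum_inner, inner_smul_left] using congrArg (fun x => inner ℝ x (μ j)) hvμ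
    calc ∑ i, v i * ‖μ i - μ j‖ ^ 2
        = ∑ i, (v i * ‖μ i‖ ^ 2 - 2 * (v i * inner ℝ (μ i) (μ j)) + v i * ‖μ j‖ ^ 2) :=
          Finset.sum_congr rfl fun i _ => by rw [norm_sub_sq_real]; ring
      _ = _ := by
          rw [Finset.sum_add_distrib, Finset.sum_sub_distrib, ← Finset.mul_sum, h1,
            ← Finset.sum_mul, hv]
          ring
  have : 0 ≤ ∑ i, v i * ‖μ i - μ j‖ ^ 2 := by
    refine Finset.sum_nonneg fun i _ => ?_
    by_cases hij : i = j
    · simp [hij]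
    · exact mul_nonneg (hcon i hij).le (sq_nonneg _)
  linarith

/-- Up to a constant, every vector orthogonal to the dependence is given by a linear functional on
the points. -/
theorem Generic.exists_eq_add_inner {m : ℕ} (hm : 3 ≤ m)
    {μ : Fin m → EuclideanSpace ℝ (Fin (m - 2))} (h : Generic μ) {v : Fin m → ℝ}
    (hv : ∑ i, v i = 0) (hvμ : ∑ i, v i • μ i = 0)
    (hI : ∀ I : Finset (Fin m), I.Nonempty → I ≠ Finset.univ → ∑ i ∈ I, v i ≠ 0)
    {z : Fin m → ℝ} (hz : ∑ i, v i * z i = 0) :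
    ∃ (a : ℝ) (y : EuclideanSpace ℝ (Fin (m - 2))), ∀ i, z i = a + inner ℝ y (μ i) := by
  let a : Fin m := ⟨0, by omega⟩
  let b : Fin m := ⟨1, by omega⟩
  have hab : a ≠ b := by simp [a, b]
  obtain ⟨t, ht, hts, hst, -⟩ := (Finset.univ \ {a, b} : Finset (Fin m)).exists_fin_embedding
    (N := m - 2) (by
      rw [Finset.card_sdiff_of_subset (Finset.subset_univ _), Finset.card_pair hab]; simp)
  have hli := h.1.linearIndependent (p := fun _ => a) ht (fun _ l h0 => by
    have := hts l
    simp [← h0] at this)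
  obtain ⟨y, hy⟩ := hli.exists_inner_eq fun k => z (t k) - z a
  have hne : ∀ i, i ≠ b → z i = z a - inner ℝ y (μ a) + inner ℝ y (μ i) := by
    intro i hib
    by_cases hia : i = a
    · rw [hia]; ring
    · obtain ⟨k, rfl⟩ := hst i (by simp [hia, hib])
      have := hy k
      rw [inner_sub_right] at this
      linarith
  refine ⟨z a - inner ℝ y (μ a), y, fun i => ?_⟩
  by_cases hib : i = b
  · have h1 : ∑ i, v i * inner ℝ y (μ i) = 0 := by
      simpa [inner_sum, inner_smul_right] using congrArg (fun x => inner ℝ y x) hvμ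
    have h2 : ∑ i, v i * (z i - (z a - inner ℝ y (μ a) + inner ℝ y (μ i))) = 0 := by
      simp only [mul_sub, mul_add, Finset.sum_sub_distrib, Finset.sum_add_distrib, hz, h1,
        ← Finset.sum_mul, hv]
      ring
    rw [Finset.sum_eq_single_of_mem b (Finset.mem_univ _) fun i _ hi => by
      rw [← hne i hi, sub_self, mul_zero]] at h2
    have hvb : v b ≠ 0 := by
      simpa using hI {b} (Finset.singleton_nonempty b) (fun h => hab (by
        have := Finset.mem_univ a
        rwa [← h, Finset.mem_singleton] at this))
    rw [hib]
    have := (mul_eq_zero.1 h2).resolve_left hvb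
    linarith
  · exact hne i hib

/-- Abel summation: an antitone sequence pairs nonpositively with a sequence of total zero all of
whose partial sums are nonpositive. -/
theorem Fin.sum_mul_nonpos_of_antitone {m : ℕ} {u z : Fin m → ℝ} (hu : ∑ i, u i = 0)
    (hpartial : ∀ k, ∑ i ∈ Finset.Iio k, u i ≤ 0) (hz : Antitone z) : ∑ i, u i * z i ≤ 0 := by
  let u' : ℕ → ℝ := fun n => if h : n < m then u ⟨n, h⟩ else 0
  let z' : ℕ → ℝ := fun n => if h : n < m then z ⟨n, h⟩ else 0
  have hu' : ∀ i : Fin m, u' i = u i := fun i => by simp [u']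
  have hz' : ∀ i : Fin m, z' i = z i := fun i => by simp [z']
  have hsum : ∑ i, u i * z i = ∑ i ∈ Finset.range m, z' i • u' i := by
    rw [← Fin.sum_univ_eq_sum_range (fun i => z' i • u' i) m]
    exact Finset.sum_congr rfl fun i _ => by rw [hu', hz', smul_eq_mul, mul_comm]
  have htot : ∑ i ∈ Finset.range m, u' i = 0 := by
    rw [← Fin.sum_univ_eq_sum_range u' m, ← hu]
    exact Finset.sum_congr rfl fun i _ => hu' i
  rw [hsum, Finset.sum_range_by_parts, htot, smul_zero, zero_sub, neg_nonpos]
  refine Finset.sum_nonneg fun i hi => ?_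
  have him : i + 1 < m := by
    have := Finset.mem_range.1 hi
    omega
  refine mul_nonneg_of_nonpos_of_nonpos ?_ ?_
  · rw [sub_nonpos]
    simp only [z', him, Nat.lt_of_succ_lt him, dif_pos]
    exact hz (Fin.mk_le_mk.2 (Nat.le_succ i))
  · have : ∑ j ∈ Finset.range (i + 1), u' j = ∑ j ∈ Finset.Iio (⟨i + 1, him⟩ : Fin m), u j := by
      rw [← Nat.Iio_eq_range, ← Fin.map_valEmbedding_Iio ⟨i + 1, him⟩, Finset.sum_map]
      exact Finset.sum_congr rfl fun i _ => hu' i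
    rw [this]
    exact hpartial _

/-- The ranking pattern of generic points is determined by the signs of the partial sums of the
dependence. -/
theorem Generic.mem_rankingPatternUF_iff {m : ℕ} (hm : 3 ≤ m)
    {μ : Fin m → EuclideanSpace ℝ (Fin (m - 2))} (h : Generic μ) {v : Fin m → ℝ}
    (hv : ∑ i, v i = 0) (hvμ : ∑ i, v i • μ i = 0) (hneg : ∑ i, v i * ‖μ i‖ ^ 2 < 0)
    (hI : ∀ I : Finset (Fin m), I.Nonempty → I ≠ Finset.univ → ∑ i ∈ I, v i ≠ 0)
    (σ : Equiv.Perm (Fin m)) :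
    σ ∈ rankingPatternUF μ ↔ ∃ k, 0 < ∑ i ∈ Finset.Iio k, v (σ i) := by
  have hdist (y : EuclideanSpace ℝ (Fin (m - 2))) (i : Fin m) :
      ‖y - μ i‖ ^ 2 = ‖y‖ ^ 2 - 2 * inner ℝ y (μ i) + ‖μ i‖ ^ 2 := norm_sub_sq_real _ _
  have hinner (y : EuclideanSpace ℝ (Fin (m - 2))) : ∑ i, v i * inner ℝ y (μ i) = 0 := by
    simpa [inner_sum, inner_smul_right] using congrArg (fun x => inner ℝ y x) hvμ
  constructor
  · rintro ⟨y, hy⟩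
    by_contra! hcon
    have hanti : Antitone fun k => -‖y - μ (σ k)‖ ^ 2 := by
      intro k l hkl
      rcases hkl.eq_or_lt with rfl | hlt
      · exact le_rfl
      · have := hy k l hlt
        simp only
        gcongr
    have hle := Fin.sum_mul_nonpos_of_antitone (u := fun i => v (σ i))
      (by rw [Equiv.sum_comp σ v, hv]) hcon hanti
    rw [Equiv.sum_comp σ fun i => v i * -‖y - μ i‖ ^ 2] at hle
    have : ∑ i, v i * -‖y - μ i‖ ^ 2 = -∑ i, v i * ‖μ i‖ ^ 2 := by
      calc ∑ i, v i * -‖y - μ i‖ ^ 2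
          = ∑ i, (-(v i * ‖y‖ ^ 2) + 2 * (v i * inner ℝ y (μ i)) - v i * ‖μ i‖ ^ 2) :=
            Finset.sum_congr rfl fun i _ => by rw [hdist]; ring
        _ = _ := by
            rw [Finset.sum_sub_distrib, Finset.sum_add_distrib, ← Finset.mul_sum, hinner,
              Finset.sum_neg_distrib, ← Finset.sum_mul, hv]
            ring
    linarith
  · rintro ⟨k, hk⟩
    set S := ∑ i ∈ Finset.Iio k, v (σ i) with hS
    set c := -∑ i, v i * ‖μ i‖ ^ 2 with hc
    set d := ∑ i : Fin m, v (σ i) * (i : ℝ) with hd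
    have hcpos : 0 < c := by linarith
    obtain ⟨ε, hε, hεd⟩ : ∃ ε > 0, 0 < c + ε * d := by
      refine ⟨c / (2 * (|d| + 1)), by positivity, ?_⟩
      have h1 : c / (2 * (|d| + 1)) * (2 * (|d| + 1)) = c := by field_simp
      have h2 : 0 < c / (2 * (|d| + 1)) := by positivity
      nlinarith [neg_abs_le d, abs_nonneg d]
    let w : Fin m → ℝ := fun i => (if i < k then (c + ε * d) / S else 0) - ε * (i : ℝ)
    have hw : ∀ i j, i < j → w j < w i := by
      intro i j hij
      have h1 : (i : ℝ) < (j : ℝ) := by exact_mod_cast hij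
      have h2 : 0 < (c + ε * d) / S := by positivity
      have h3 : ε * (i : ℝ) < ε * (j : ℝ) := by gcongr
      simp only [w]
      split_ifs with hj hi hi
      · linarith
      · exact absurd (hij.trans hj) hi
      · linarith
      · linarith
    have hvw : ∑ i, v (σ i) * w i = c := by
      simp only [w, mul_sub, Finset.sum_sub_distrib, mul_ite, mul_zero]
      rw [← Finset.sum_filter, Finset.filter_gt_eq_Iio, ← Finset.sum_mul, ← hS]
      have : ∑ i : Fin m, v (σ i) * (ε * (i : ℝ)) = ε * d := by
        rw [hd, Finset.mul_sum]
        exact Finset.sum_congr rfl fun i _ => by ring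
      rw [this]
      field_simp
      ring
    have hz : ∑ i, v i * (w (σ.symm i) + ‖μ i‖ ^ 2) = 0 := by
      simp only [mul_add, Finset.sum_add_distrib]
      rw [← Equiv.sum_comp σ fun i => v i * w (σ.symm i)]
      simp only [Equiv.symm_apply_apply, hvw, hc]
      ring
    obtain ⟨a, y, hy⟩ := h.exists_eq_add_inner hm hv hvμ hI hz
    refine ⟨(1 / 2 : ℝ) • y, fun i j hij => ?_⟩
    refine lt_of_pow_lt_pow_left₀ 2 (norm_nonneg _) ?_
    have hi := hy (σ i)
    have hj := hy (σ j)
    have := hw i j hij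
    simp only [Equiv.symm_apply_apply] at hi hj
    rw [hdist, hdist, real_inner_smul_left, real_inner_smul_left]
    linarith

/-- The signs of all subset sums of a vector. -/
noncomputable def subsetSumSigns {m : ℕ} (v : Fin m → ℝ) (I : Finset (Fin m)) : SignType :=
  SignType.sign (∑ i ∈ I, v i)

theorem ContinuousAt.eventually_sign_eq {α : Type*} [TopologicalSpace α] {f : α → ℝ} {a : α}
    (hf : ContinuousAt f a) (ha : f a ≠ 0) :
    ∀ᶠ x in nhds a, SignType.sign (f x) = SignType.sign (f a) := by
  have h : ContinuousAt (fun x => SignType.sign (f x)) a :=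
    (continuousAt_sign_of_ne_zero ha).comp hf
  exact h.eventually (isOpen_discrete {SignType.sign (f a)} |>.eventually_mem rfl)

/-- A vector with nonzero proper subset sums can be made injective without changing the signs of
its subset sums. -/
theorem exists_injective_subsetSumSigns_eq {m : ℕ} {v : Fin m → ℝ} (hv : ∑ i, v i = 0)
    (hI : ∀ I : Finset (Fin m), I.Nonempty → I ≠ Finset.univ → ∑ i ∈ I, v i ≠ 0) :
    ∃ w : Fin m → ℝ, ∑ i, w i = 0 ∧ subsetSumSigns w = subsetSumSigns v ∧
      Function.Injective w := by
  let c : ℝ := (∑ i : Fin m, (i : ℝ)) / m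
  let u : Fin m → ℝ := fun i => (i : ℝ) - c
  have hu : ∑ i, u i = 0 := by
    rcases Nat.eq_zero_or_pos m with rfl | hm
    · simp
    · have : (m : ℝ) ≠ 0 := by positivity
      simp only [u, c, Finset.sum_sub_distrib, Finset.sum_const, Finset.card_univ,
        Fintype.card_fin, nsmul_eq_mul]
      field_simp
      ring
  have hu_inj : ∀ i j, i ≠ j → u i - u j ≠ 0 := by
    intro i j hij h
    apply hij
    have : (i : ℝ) = (j : ℝ) := by simp only [u] at h; linarith
    exact Fin.ext (by exact_mod_cast this)
  let w : ℝ → Fin m → ℝ := fun ε i => v i + ε * u i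
  have hsum (ε : ℝ) (I : Finset (Fin m)) :
      ∑ i ∈ I, w ε i = ∑ i ∈ I, v i + ε * ∑ i ∈ I, u i := by
    rw [Finset.sum_add_distrib, Finset.mul_sum]
  have h1 : ∀ᶠ ε in nhdsWithin (0 : ℝ) {0}ᶜ, ∀ I, subsetSumSigns (w ε) I = subsetSumSigns v I := by
    rw [Filter.eventually_all]
    intro I
    by_cases hI1 : I.Nonempty
    · by_cases hI2 : I = Finset.univ
      · refine Filter.Eventually.of_forall fun ε => ?_
        simp [subsetSumSigns, hsum, hI2, hv, hu]
      · refine Filter.Eventually.filter_mono nhdsWithin_le_nhds ?_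
        have := ContinuousAt.eventually_sign_eq (a := (0 : ℝ))
          (f := fun ε => ∑ i ∈ I, v i + ε * ∑ i ∈ I, u i) (by fun_prop) (by simpa using hI I hI1 hI2)
        filter_upwards [this] with ε hε
        simp only [subsetSumSigns, hsum, hε, zero_mul, add_zero]
    · refine Filter.Eventually.of_forall fun ε => ?_
      rw [Finset.not_nonempty_iff_eq_empty.1 hI1]
      simp [subsetSumSigns]
  have h2 : ∀ᶠ ε in nhdsWithin (0 : ℝ) {0}ᶜ, ∀ i j, i ≠ j → w ε i ≠ w ε j := by
    simp only [Filter.eventually_all]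
    intro i j hij
    by_cases hvij : v i = v j
    · filter_upwards [self_mem_nhdsWithin] with ε hε heq
      have : ε * (u i - u j) = 0 := by simp only [w] at heq; linarith
      exact (mul_ne_zero hε (hu_inj i j hij)) this
    · have hc : ContinuousAt (fun ε => w ε i - w ε j) 0 := by simp only [w]; fun_prop
      have := (hc.eventually_ne (y := 0) (by simpa [w, sub_eq_zero] using hvij)).filter_mono
        (nhdsWithin_le_nhds (s := {0}ᶜ))
      filter_upwards [this] with ε hε heq
      exact hε (sub_eq_zero.2 heq)
  obtain ⟨ε, hε1, hε2⟩ := (h1.and h2).exists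
  exact ⟨w ε, by rw [hsum, hv, hu]; simp, funext hε1,
    fun i j hij => by_contra fun h => hε2 i j h hij⟩

theorem exists_perm_strictAnti {m : ℕ} {w : Fin m → ℝ} (hw : Function.Injective w) :
    ∃ σ : Equiv.Perm (Fin m), StrictAnti (w ∘ σ) := by
  have hmono := Tuple.monotone_sort (fun i => -w i)
  have hanti : Antitone (w ∘ Tuple.sort fun i => -w i) := fun i j hij => by
    have := hmono hij
    simpa using this
  exact ⟨_, hanti.strictAnti_of_injective (hw.comp (Equiv.injective _))⟩

/-- The rankings along which some partial sum of `w` is positive. -/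
def positivePartialSumRankings {m : ℕ} (w : Fin m → ℝ) : Set (Equiv.Perm (Fin m)) :=
  {σ | ∃ k, 0 < ∑ i ∈ Finset.Iio k, w (σ i)}

theorem positivePartialSumRankings_congr {m : ℕ} {v w : Fin m → ℝ}
    (h : subsetSumSigns v = subsetSumSigns w) :
    positivePartialSumRankings v = positivePartialSumRankings w := by
  have key (u : Fin m → ℝ) (σ : Equiv.Perm (Fin m)) (k : Fin m) :
      0 < ∑ i ∈ Finset.Iio k, u (σ i) ↔
        subsetSumSigns u ((Finset.Iio k).map σ.toEmbedding) = 1 := by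
    simp [subsetSumSigns, sign_eq_one_iff]
  ext σ
  simp only [positivePartialSumRankings, Set.mem_ofPred_eq, key, h]

/-- The points of `H0` with nonzero proper subset sums. -/
def IsSubsetGeneric {m : ℕ} (w : Fin m → ℝ) : Prop :=
  ∑ i, w i = 0 ∧ ∀ I : Finset (Fin m), I.Nonempty → I ≠ Finset.univ → ∑ i ∈ I, w i ≠ 0

theorem exists_strictAnti_of_mem_rankingPatternsUF {m : ℕ} (hm : 3 ≤ m)
    {R : Set (Equiv.Perm (Fin m))} (hR : R ∈ rankingPatternsUF m) :
    ∃ (w : Fin m → ℝ) (σ : Equiv.Perm (Fin m)), IsSubsetGeneric w ∧ StrictAnti w ∧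
      (∀ j, ∃ i, i ≠ j ∧ w i ≤ 0) ∧ R = (fun τ => σ * τ) '' positivePartialSumRankings w := by
  obtain ⟨μ, hμ, rfl⟩ := hR
  obtain ⟨v, hv, hvμ, hneg, hI⟩ := hμ.exists_dependence hm
  obtain ⟨u, hu, huv, hinj⟩ := exists_injective_subsetSumSigns_eq hv hI
  obtain ⟨σ, hσ⟩ := exists_perm_strictAnti hinj
  have hmap (I : Finset (Fin m)) : ∑ i ∈ I, (u ∘ σ) i = ∑ i ∈ I.map σ.toEmbedding, u i := by
    simp
  refine ⟨u ∘ σ, σ, ⟨?_, fun I h1 h2 h3 => ?_⟩, hσ, fun j => ?_, ?_⟩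
  · rw [hmap, Finset.map_univ_equiv, hu]
  · rw [hmap, ← sign_eq_zero_iff] at h3
    have h4 := congrFun huv (I.map σ.toEmbedding)
    simp only [subsetSumSigns] at h4
    rw [h4, sign_eq_zero_iff] at h3
    refine hI _ (h1.map) (fun h5 => h2 ?_) h3
    rw [← Finset.map_univ_equiv σ] at h5
    exact Finset.map_injective _ h5
  · obtain ⟨i, hij, hi⟩ := exists_ne_nonpos_of_dependence hv hvμ hneg (σ j)
    refine ⟨σ.symm i, fun h => hij (by simp [← h]), ?_⟩
    have h4 := congrFun huv {i}
    simp only [subsetSumSigns, Finset.sum_singleton] at h4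
    simp only [Function.comp_apply, Equiv.apply_symm_apply]
    by_contra! hpos
    rw [sign_pos hpos, eq_comm, sign_eq_one_iff] at h4
    linarith
  · ext τ
    rw [hμ.mem_rankingPatternUF_iff hm hv hvμ hneg hI]
    change τ ∈ positivePartialSumRankings v ↔ _
    rw [← positivePartialSumRankings_congr huv]
    constructor
    · rintro ⟨k, hk⟩
      exact ⟨σ⁻¹ * τ, ⟨k, by simpa using hk⟩, by simp⟩
    · rintro ⟨ρ, ⟨k, hk⟩, rfl⟩
      exact ⟨k, by simpa using hk⟩

/-- A decreasing subset-generic vector with exactly one negative entry. -/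
theorem exists_strictAnti_one_neg {m : ℕ} (hm : 3 ≤ m) :
    ∃ (w : Fin m → ℝ) (j : Fin m), IsSubsetGeneric w ∧ StrictAnti w ∧ ∀ i, i ≠ j → 0 < w i := by
  classical
  let j : Fin m := ⟨m - 1, by omega⟩
  let s : ℝ := ∑ i ∈ Finset.univ.erase j, ((m : ℝ) - (i : ℝ))
  let w : Fin m → ℝ := fun i => if i = j then -s else (m : ℝ) - (i : ℝ)
  have hlt (i : Fin m) : (0 : ℝ) < (m : ℝ) - (i : ℝ) := sub_pos.2 (by exact_mod_cast i.2)
  have hpos : ∀ i, i ≠ j → 0 < w i := fun i hi => by simp only [w, if_neg hi]; exact hlt i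
  have hs : 0 ≤ s := Finset.sum_nonneg fun i _ => (hlt i).le
  have hsum : ∑ i, w i = 0 := by
    rw [← Finset.add_sum_erase _ _ (Finset.mem_univ j)]
    have : ∑ i ∈ Finset.univ.erase j, w i = s :=
      Finset.sum_congr rfl fun i hi => by simp only [w, if_neg (Finset.ne_of_mem_erase hi)]
    rw [this]
    simp [w]
  have hI (I : Finset (Fin m)) (h1 : I.Nonempty) (h2 : j ∉ I) : 0 < ∑ i ∈ I, w i :=
    Finset.sum_pos (fun i hi => hpos i fun h => h2 (h ▸ hi)) h1
  refine ⟨w, j, ⟨hsum, fun I h1 h2 h3 => ?_⟩, fun a b hab => ?_, hpos⟩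
  · by_cases hj : j ∈ I
    · have h4 := hI Iᶜ (by
        rw [Finset.nonempty_iff_ne_empty]
        exact fun h => h2 (by simpa using h)) (by simpa using hj)
      have h5 := Finset.sum_add_sum_compl I w
      linarith
    · exact (hI I h1 hj).ne' h3
  · have haj : a ≠ j := by
      rintro rfl
      have := b.2
      rw [Fin.lt_def] at hab
      simp only [j] at hab
      omega
    by_cases hbj : b = j
    · have := hpos a haj
      simp only [hbj, w, if_true] at this ⊢
      linarith
    · have : (a : ℝ) < (b : ℝ) := by exact_mod_cast hab
      simp only [w, if_neg haj, if_neg hbj]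
      linarith

/-- The complement in `H0` of the all-subset arrangement and the braid arrangement. -/
abbrev ChamberComplement (m : ℕ) : Type :=
  {x : EuclideanSpace ℝ (Fin m) // (∑ i, x i = 0) ∧
    (∀ I : Finset (Fin m), I.Nonempty → I ≠ Finset.univ → ∑ i ∈ I, x i ≠ 0) ∧
    ∀ i j : Fin m, i < j → x i ≠ x j}

/-- The signs of all subset sums and of all coordinate differences. -/
noncomputable def chamberSigns {m : ℕ} (x : EuclideanSpace ℝ (Fin m)) :
    (Finset (Fin m) → SignType) × (Fin m → Fin m → SignType) :=
  (subsetSumSigns fun i => x i, fun i j => SignType.sign (x i - x j))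

theorem continuous_chamberSigns (m : ℕ) :
    Continuous fun x : ChamberComplement m => chamberSigns x.1 := by
  have hcoord (i : Fin m) : Continuous fun x : ChamberComplement m => x.1 i := by fun_prop
  have hsign {f : ChamberComplement m → ℝ} (hf : Continuous f) (h0 : ∀ x, f x ≠ 0) :
      Continuous fun x => SignType.sign (f x) :=
    continuous_iff_continuousAt.2 fun x =>
      (continuousAt_sign_of_ne_zero (h0 x)).comp hf.continuousAt
  refine Continuous.prodMk (continuous_pi fun I => ?_)
    (continuous_pi fun i => continuous_pi fun j => ?_)
  · simp only [subsetSumSigns]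
    by_cases hI : I.Nonempty
    · by_cases hI' : I = Finset.univ
      · convert continuous_const (y := SignType.sign (0 : ℝ)) using 3 with x
        rw [hI', x.2.1]
      · exact hsign (continuous_finsetSum _ fun i _ => hcoord i) fun x => x.2.2.1 I hI hI'
    · rw [Finset.not_nonempty_iff_eq_empty.1 hI]
      simpa using continuous_const
  · rcases lt_trichotomy i j with hij | rfl | hij
    · exact hsign ((hcoord i).sub (hcoord j)) fun x => sub_ne_zero.2 (x.2.2.2 i j hij)
    · simpa using continuous_const
    · exact hsign ((hcoord i).sub (hcoord j)) fun x => sub_ne_zero.2 (x.2.2.2 j i hij).symm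

theorem convex_sign_eq (s : SignType) : Convex ℝ {r : ℝ | SignType.sign r = s} := by
  cases s
  · have h : {r : ℝ | SignType.sign r = SignType.zero} = {0} := Set.ext fun r => sign_eq_zero_iff
    exact h ▸ convex_singleton 0
  · have h : {r : ℝ | SignType.sign r = SignType.neg} = Set.Iio 0 :=
      Set.ext fun r => sign_eq_neg_one_iff
    exact h ▸ convex_Iio 0
  · have h : {r : ℝ | SignType.sign r = SignType.pos} = Set.Ioi 0 :=
      Set.ext fun r => sign_eq_one_iff
    exact h ▸ convex_Ioi 0

theorem convex_chamberSigns_eq {m : ℕ}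
    (s : (Finset (Fin m) → SignType) × (Fin m → Fin m → SignType)) :
    Convex ℝ {x : EuclideanSpace ℝ (Fin m) | chamberSigns x = s} := by
  intro x hx y hy a b ha hb hab
  have hx' : chamberSigns x = s := hx
  have hy' : chamberSigns y = s := hy
  change chamberSigns (a • x + b • y) = s
  refine Prod.ext (funext fun I => ?_) (funext fun i => funext fun j => ?_)
  · have h := convex_sign_eq (s.1 I) (congrFun (congrArg Prod.fst hx') I)
      (congrFun (congrArg Prod.fst hy') I) ha hb hab
    simpa [chamberSigns, subsetSumSigns, Finset.sum_add_distrib, Finset.mul_sum] using h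
  · have h := convex_sign_eq (s.2 i j) (congrFun (congrFun (congrArg Prod.snd hx') i) j)
      (congrFun (congrFun (congrArg Prod.snd hy') i) j) ha hb hab
    have heq : (a • x + b • y) i - (a • x + b • y) j = a • (x i - x j) + b • (y i - y j) := by
      simp only [PiLp.add_apply, PiLp.smul_apply, smul_eq_mul]
      ring
    simp only [chamberSigns, heq]
    exact h

theorem chamberComplement_mk_eq_iff {m : ℕ} (x y : ChamberComplement m) :
    ConnectedComponents.mk x = ConnectedComponents.mk y ↔
      chamberSigns x.1 = chamberSigns y.1 := by
  constructor
  · intro h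
    have := congrArg (continuous_chamberSigns m).connectedComponentsLift h
    simpa only [Continuous.connectedComponentsLift_apply_coe] using this
  · intro h
    rw [ConnectedComponents.coe_eq_coe']
    let S : Set (ChamberComplement m) := {z | chamberSigns z.1 = chamberSigns y.1}
    have himage : Subtype.val '' S = {z | chamberSigns z = chamberSigns y.1} := by
      ext z
      constructor
      · rintro ⟨z, hz, rfl⟩
        exact hz
      · intro hz
        have hz' : chamberSigns z = chamberSigns y.1 := hz
        have hsub (I : Finset (Fin m)) : ∑ i ∈ I, z i = 0 ↔ ∑ i ∈ I, y.1 i = 0 := by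
          have := congrFun (congrArg Prod.fst hz') I
          simp only [chamberSigns, subsetSumSigns] at this
          rw [← sign_eq_zero_iff, this, sign_eq_zero_iff]
        have hdiff (i j : Fin m) : z i = z j ↔ y.1 i = y.1 j := by
          have := congrFun (congrFun (congrArg Prod.snd hz') i) j
          simp only [chamberSigns] at this
          rw [← sub_eq_zero, ← sign_eq_zero_iff, this, sign_eq_zero_iff, sub_eq_zero]
        exact ⟨⟨z, (hsub _).2 y.2.1, fun I h1 h2 h3 => y.2.2.1 I h1 h2 ((hsub I).1 h3),
          fun i j hij h3 => y.2.2.2 i j hij ((hdiff i j).1 h3)⟩, hz, rfl⟩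
    have hS : IsPreconnected S := by
      refine Topology.IsInducing.subtypeVal.isPreconnected_image.1 ?_
      exact himage ▸ (convex_chamberSigns_eq _).isPreconnected
    exact hS.subset_connectedComponent (x := y) rfl h

instance (m : ℕ) : Finite (ConnectedComponents (ChamberComplement m)) := by
  refine Finite.of_injective (continuous_chamberSigns m).connectedComponentsLift ?_
  intro c d h
  obtain ⟨x, rfl⟩ := ConnectedComponents.surjective_coe c
  obtain ⟨y, rfl⟩ := ConnectedComponents.surjective_coe d
  rw [Continuous.connectedComponentsLift_apply_coe,
    Continuous.connectedComponentsLift_apply_coe] at h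
  exact (chamberComplement_mk_eq_iff x y).2 h

/-- The point of the chamber complement obtained by permuting the coordinates of a decreasing
subset-generic vector. -/
noncomputable def permutedPoint {m : ℕ} {w : Fin m → ℝ} (hw : IsSubsetGeneric w)
    (hanti : StrictAnti w) (σ : Equiv.Perm (Fin m)) : ChamberComplement m :=
  ⟨WithLp.toLp 2 (w ∘ σ.symm), by
    have hmap (I : Finset (Fin m)) :
        ∑ i ∈ I, w (σ.symm i) = ∑ i ∈ I.map σ.symm.toEmbedding, w i := by simp
    refine ⟨?_, fun I h1 h2 => ?_, fun i j hij h => ?_⟩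
    · simpa using (Equiv.sum_comp σ.symm w).trans hw.1
    · simp only [Function.comp_apply, hmap]
      refine hw.2 _ h1.map fun h => h2 ?_
      rw [← Finset.map_univ_equiv σ.symm] at h
      exact Finset.map_injective _ h
    · exact hij.ne (σ.symm.injective (hanti.injective h))⟩

theorem permutedPoint_mk_eq {m : ℕ} {w w' : Fin m → ℝ} {hw : IsSubsetGeneric w}
    {hanti : StrictAnti w} {hw' : IsSubsetGeneric w'} {hanti' : StrictAnti w'}
    {σ τ : Equiv.Perm (Fin m)}
    (h : ConnectedComponents.mk (permutedPoint hw hanti σ) =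
      ConnectedComponents.mk (permutedPoint hw' hanti' τ)) :
    σ = τ ∧ subsetSumSigns w = subsetSumSigns w' := by
  rw [chamberComplement_mk_eq_iff] at h
  have hστ : σ = τ := by
    have hmono : StrictMono fun i => τ.symm (σ i) := by
      intro i j hij
      have h1 := congrFun (congrFun (congrArg Prod.snd h) (σ i)) (σ j)
      simp only [chamberSigns, permutedPoint, Function.comp_apply, Equiv.symm_apply_apply] at h1
      rw [sign_pos (sub_pos.2 (hanti hij)), eq_comm, sign_eq_one_iff, sub_pos] at h1
      exact hanti'.lt_iff_gt.1 h1
    have hid : hmono.orderIsoOfSurjective _ (σ.trans τ.symm).surjective = OrderIso.refl _ :=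
      Subsingleton.elim _ _
    ext i
    have := congrArg (fun e : Fin m ≃o Fin m => e i) hid
    simp only [OrderIso.refl_apply] at this
    rw [← (Equiv.symm_apply_eq τ).1 this]
  subst hστ
  refine ⟨rfl, funext fun I => ?_⟩
  have h1 := congrFun (congrArg Prod.fst h) (I.map σ.toEmbedding)
  simpa [chamberSigns, permutedPoint, subsetSumSigns] using h1

/-- Corollary 6.2 (upper bound): the number of inequivalent ranking patterns of
unfolding models of codimension one is at most `N/m! − 1`, where `N` is the
number of chambers of the arrangement `A⁰ ∪ B_m^{H0}` in `H0`, i.e. the number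
of connected components of
`{x ∈ H0 : all nonempty proper subset sums are nonzero and all coordinates are
distinct}`. -/
theorem card_inequiv_rankingPatternsUF_le {m : ℕ} (hm : 3 ≤ m) :
    (Nat.card
        (Quot fun (R R' : rankingPatternsUF m) => patternEquiv R.1 R'.1) : ℝ) ≤
      (Nat.card (ConnectedComponents
          {x : EuclideanSpace ℝ (Fin m) // (∑ i, x i = 0) ∧
            (∀ I : Finset (Fin m), I.Nonempty → I ≠ Finset.univ →
              ∑ i ∈ I, x i ≠ 0) ∧
            ∀ i j : Fin m, i < j → x i ≠ x j}) : ℝ) /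
          (Nat.factorial m) - 1 := by
  classical
  let Q := Quot fun (R R' : rankingPatternsUF m) => patternEquiv R.1 R'.1
  choose w σ hw hanti hnonpos hR using fun q : Q =>
    exists_strictAnti_of_mem_rankingPatternsUF hm q.out.2
  obtain ⟨w₀, j, hw₀, hanti₀, hpos₀⟩ := exists_strictAnti_one_neg hm
  have hQ : ∀ q r, subsetSumSigns (w q) = subsetSumSigns (w r) → q = r := by
    intro q r h
    rw [← Quot.out_eq q, ← Quot.out_eq r]
    refine Quot.sound ⟨σ q * (σ r)⁻¹, ?_⟩
    rw [hR q, hR r, positivePartialSumRankings_congr h, Set.image_image]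
    simp [mul_assoc]
  have hne : ∀ q, subsetSumSigns (w q) ≠ subsetSumSigns w₀ := by
    intro q h
    obtain ⟨i, hij, hi⟩ := hnonpos q j
    have := congrFun h {i}
    simp only [subsetSumSigns, Finset.sum_singleton] at this
    rw [sign_pos (hpos₀ i hij), sign_eq_one_iff] at this
    linarith
  let Φ : Equiv.Perm (Fin m) × Option Q → ConnectedComponents (ChamberComplement m) := fun p =>
    p.2.elim (ConnectedComponents.mk (permutedPoint hw₀ hanti₀ p.1))
      fun q => ConnectedComponents.mk (permutedPoint (hw q) (hanti q) p.1)
  have hΦ : Function.Injective Φ := by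
    rintro ⟨ρ, _ | q⟩ ⟨τ, _ | r⟩ h
    · exact Prod.ext (permutedPoint_mk_eq h).1 rfl
    · exact absurd (permutedPoint_mk_eq h).2.symm (hne r)
    · exact absurd (permutedPoint_mk_eq h).2 (hne q)
    · exact Prod.ext (permutedPoint_mk_eq h).1
        (congrArg some (hQ q r (permutedPoint_mk_eq h).2))
  have : Finite Q := Finite.of_injective (fun q => Φ (1, some q)) fun q r h => by
    simpa using hΦ h
  have hcard := Nat.card_le_card_of_injective Φ hΦ
  rw [Nat.card_prod, Finite.card_option, Nat.card_perm, Nat.card_fin] at hcard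
  rw [le_sub_iff_add_le, le_div_iff₀ (by positivity), mul_comm]
  exact_mod_cast hcard
end
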